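/- arXiv:2305.08888 — 2 statements merged into one kernel-verified Lean document; each statement's English description precedes it below -/
import Mathlib

section
/- Suppose n ≡ 3 (mod 9) and n ≢ 12 (mod 27). Write Δ_n = n²+3n+9 = de²c³ (d, e squarefree coprime positive, c positive), and let a₀, a₁ be integers with ec = a₀² - a₀a₁ + a₁² and a₀ + a₁ζ dividing A_n = n + 3 + 3ζ in ℤ[ζ]. Let ρ be a root of f_n and ρ' = -1/(1+ρ). Then α := (3a₀ρ + 3a₁ρ' - n(a₀+a₁))/(ec²) is an algebraic integer, and the ring of integers of L_n = ℚ(ρ) decomposes as O_{L_n} = ℤ[G]·α ⊕ ℤ, where G = Gal(L_n/ℚ) acts on α by conjugation. -/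
open Polynomial

theorem c3_prime_ne3 (p u v w g h D : ℤ) (hp : Prime p) (hp3 : ¬ p ∣ 3)
    (hD : g ^ 2 - g * h + h ^ 2 = D) (hsq : Squarefree D)
    (h1 : p ∣ 3 * w) (h2 : p ^ 2 ∣ 3 * w ^ 2 - 3 * D * (u ^ 2 - u * v + v ^ 2))
    (h3 : p ^ 3 ∣ w ^ 3 - 3 * D * (u ^ 2 - u * v + v ^ 2) * w +
      D * ((u ^ 3 + v ^ 3 - 3 * u * v ^ 2) * (2 * g - h)
        - (3 * u ^ 2 * v - 3 * u * v ^ 2) * (g + h))) :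
    p ∣ u ∧ p ∣ v ∧ p ∣ w := by
  have hw : p ∣ w := (hp.dvd_or_dvd h1).resolve_left hp3
  have hp0 : p ≠ 0 := hp.ne_zero
  have tau : ∀ x y : ℤ, p ∣ 2 * x - y → p ∣ x ^ 2 - x * y + y ^ 2 → p ∣ x ∧ p ∣ y := by
    intro x y ha hb
    have hy : p ∣ y := by
      have : p ∣ 3 * y ^ 2 := by
        have : 3 * y ^ 2 = 4 * (x ^ 2 - x * y + y ^ 2) - (2 * x - y) * (2 * x - y) := by ring
        rw [this]
        exact dvd_sub (Dvd.dvd.mul_left hb _) (Dvd.dvd.mul_left ha _)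
      exact hp.dvd_of_dvd_pow ((hp.dvd_or_dvd this).resolve_left hp3)
    refine ⟨?_, hy⟩
    have : p ∣ x ^ 2 := by
      have : x ^ 2 = (x ^ 2 - x * y + y ^ 2) + y * (x - y) := by ring
      rw [this]
      exact dvd_add hb (Dvd.dvd.mul_right hy _)
    exact hp.dvd_of_dvd_pow this
  set N := u ^ 2 - u * v + v ^ 2 with hN
  set X := u ^ 3 + v ^ 3 - 3 * u * v ^ 2 with hX
  set Y := 3 * u ^ 2 * v - 3 * u * v ^ 2 with hY
  have cop : ∀ j : ℕ, ∀ m, p ^ j ∣ 3 * m → p ^ j ∣ m := by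
    intro j m hm
    refine IsCoprime.dvd_of_dvd_mul_left ?_ hm
    exact IsCoprime.pow_left ((Prime.coprime_iff_not_dvd hp).2 hp3)
  obtain ⟨w', rfl⟩ := hw
  have h2' : p ^ 2 ∣ D * N := by
    apply cop
    obtain ⟨r, hr⟩ := h2
    exact ⟨3 * w' ^ 2 - r, by linear_combination (-1) * hr⟩
  have h3' : p ^ 3 ∣ D * (X * (2 * g - h) - Y * (g + h)) := by
    obtain ⟨r, hr⟩ := h3
    obtain ⟨q, hq⟩ := h2'
    exact ⟨r - w' ^ 3 + 3 * q * w', by linear_combination hr + 3 * p * w' * hq⟩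
  set x := X * g - Y * h with hx
  set y := X * h + Y * g - Y * h with hy
  have hNt : x ^ 2 - x * y + y ^ 2 = N ^ 3 * D := by
    rw [← hD, hx, hy, hX, hY, hN]; ring
  have htr : X * (2 * g - h) - Y * (g + h) = 2 * x - y := by rw [hx, hy]; ring
  rw [htr] at h3'
  have hXD : X * D = x * (g - h) + y * h := by rw [hx, hy, ← hD]; ring
  have hYD : Y * D = y * g - x * h := by rw [hx, hy, ← hD]; ring
  have key : p ∣ N ∧ p ∣ Y := by
    by_cases hpD : p ∣ D
    · obtain ⟨D', rfl⟩ := hpD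
      have hD' : ¬ p ∣ D' := by
        rintro ⟨q, rfl⟩
        exact hp.not_isUnit (hsq p ⟨q, by ring⟩)
      have a1 : p ∣ N := by
        have : p ∣ D' * N := by
          obtain ⟨q, hq⟩ := h2'
          exact ⟨q, mul_left_cancel₀ hp0 (by linear_combination hq)⟩
        exact (hp.dvd_or_dvd this).resolve_left hD'
      obtain ⟨N', hN'⟩ := a1
      have a2 : p ^ 2 ∣ 2 * x - y := by
        have : p ^ 2 ∣ D' * (2 * x - y) := by
          obtain ⟨q, hq⟩ := h3'
          exact ⟨q, mul_left_cancel₀ hp0 (by linear_combination hq)⟩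
        exact IsCoprime.dvd_of_dvd_mul_left
          (IsCoprime.pow_left ((Prime.coprime_iff_not_dvd hp).2 hD')) this
      obtain ⟨q, hq⟩ := a2
      obtain ⟨⟨x1, hx1⟩, ⟨y1, hy1⟩⟩ := tau x y ⟨p * q, by linear_combination hq⟩
        ⟨N' ^ 3 * p ^ 3 * D', by rw [hNt, hN']; ring⟩
      have b : p ∣ x1 ∧ p ∣ y1 := by
        apply tau
        · exact ⟨q, mul_left_cancel₀ hp0 (by rw [hx1, hy1] at hq; linear_combination hq)⟩
        · refine ⟨p * N' ^ 3 * D', mul_left_cancel₀ (pow_ne_zero 2 hp0) ?_⟩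
          rw [hx1, hy1, hN'] at hNt
          linear_combination hNt
      obtain ⟨⟨x2, hx2⟩, ⟨y2, hy2⟩⟩ := b
      refine ⟨⟨N', hN'⟩, ?_⟩
      have : p ∣ Y * D' := by
        refine ⟨y2 * g - x2 * h, mul_left_cancel₀ hp0 ?_⟩
        rw [hx1, hy1, hx2, hy2] at hYD
        linear_combination hYD
      exact (hp.dvd_or_dvd this).resolve_right hD'
    · have a1 : p ∣ N := (hp.dvd_or_dvd (dvd_trans (dvd_pow_self p two_ne_zero) h2')).resolve_left hpD
      have a2 : p ∣ 2 * x - y :=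
        (hp.dvd_or_dvd (dvd_trans (dvd_pow_self p three_ne_zero) h3')).resolve_left hpD
      obtain ⟨b1, b2⟩ := tau x y a2 (by
        rw [hNt]; exact Dvd.dvd.mul_right (dvd_pow a1 three_ne_zero) _)
      refine ⟨a1, ?_⟩
      have : p ∣ Y * D := by
        rw [hYD]; exact dvd_sub (Dvd.dvd.mul_right b2 _) (Dvd.dvd.mul_right b1 _)
      exact (hp.dvd_or_dvd this).resolve_right hpD
  obtain ⟨kN, kY⟩ := key
  have hv_of : p ∣ u → p ∣ u ∧ p ∣ v := by
    intro hu
    refine ⟨hu, hp.dvd_of_dvd_pow (n := 2) ?_⟩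
    have : v ^ 2 = N - u * (u - v) := by rw [hN]; ring
    rw [this]; exact dvd_sub kN (Dvd.dvd.mul_right hu _)
  have hu_of : p ∣ v → p ∣ u ∧ p ∣ v := by
    intro hu
    refine ⟨hp.dvd_of_dvd_pow (n := 2) ?_, hu⟩
    have : u ^ 2 = N - v * (v - u) := by rw [hN]; ring
    rw [this]; exact dvd_sub kN (Dvd.dvd.mul_right hu _)
  have fin : p ∣ u ∧ p ∣ v := by
    have e : Y = 3 * (u * v * (u - v)) := by rw [hY]; ring
    rw [e] at kY
    rcases hp.dvd_or_dvd ((hp.dvd_or_dvd kY).resolve_left hp3) with k | k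
    · rcases hp.dvd_or_dvd k with k | k
      · exact hv_of k
      · exact hu_of k
    · have : p ∣ u * v := by
        have : u * v = N - (u - v) * (u - v) := by rw [hN]; ring
        rw [this]; exact dvd_sub kN (Dvd.dvd.mul_right k _)
      rcases hp.dvd_or_dvd this with k | k
      · exact hv_of k
      · exact hu_of k
  exact ⟨fin.1, fin.2, Dvd.intro _ rfl⟩

theorem c3_mod3 (w : ℤ) (hw : ¬ (3 : ℤ) ∣ w) : ∃ j, w = 3 * j + 1 ∨ w = 3 * j - 1 := by
  rcases (by omega : w % 3 = 1 ∨ w % 3 = 2) with h | h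
  · exact ⟨w / 3, by omega⟩
  · exact ⟨w / 3 + 1, by omega⟩

theorem c3_norm_mod3 (a b : ℤ) (hh : ¬ (3 : ℤ) ∣ a ^ 2 - a * b + b ^ 2) :
    ∃ j, a ^ 2 - a * b + b ^ 2 = 3 * j + 1 := by
  have : ¬ (3 : ℤ) ∣ a + b := by
    rintro ⟨q, hq⟩
    exact hh ⟨3 * q ^ 2 - a * b, by linear_combination (a + b + 3 * q) * hq⟩
  obtain ⟨j, hj | hj⟩ := c3_mod3 _ this
  · exact ⟨3 * j ^ 2 + 2 * j - a * b, by linear_combination (a + b + 3 * j + 1) * hj⟩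
  · exact ⟨3 * j ^ 2 - 2 * j - a * b, by linear_combination (a + b + 3 * j - 1) * hj⟩

theorem c3_prime_eq3 (u v w g h D : ℤ)
    (hD : g ^ 2 - g * h + h ^ 2 = D) (hD3 : ¬ (3 : ℤ) ∣ D) (hh : ¬ (3 : ℤ) ∣ h)
    (h2 : (3 : ℤ) ^ 2 ∣ 3 * w ^ 2 - 3 * D * (u ^ 2 - u * v + v ^ 2))
    (h3 : (3 : ℤ) ^ 3 ∣ w ^ 3 - 3 * D * (u ^ 2 - u * v + v ^ 2) * w +
      D * ((u ^ 3 + v ^ 3 - 3 * u * v ^ 2) * (2 * g - h)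
        - (3 * u ^ 2 * v - 3 * u * v ^ 2) * (g + h))) :
    (3 : ℤ) ∣ u ∧ (3 : ℤ) ∣ v ∧ (3 : ℤ) ∣ w := by
  have p3 : Prime (3 : ℤ) := Int.prime_three
  obtain ⟨D1, hD1⟩ := c3_norm_mod3 g h (by rw [hD]; exact hD3)
  rw [hD] at hD1
  obtain ⟨r, hr⟩ := h2
  obtain ⟨q, hq⟩ := h3
  by_cases hw : (3 : ℤ) ∣ w
  · obtain ⟨w', rfl⟩ := hw
    have hN : (3 : ℤ) ∣ u ^ 2 - u * v + v ^ 2 := by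
      have : (3 : ℤ) ∣ D * (u ^ 2 - u * v + v ^ 2) := ⟨3 * w' ^ 2 - r, by linarith⟩
      exact (p3.dvd_or_dvd this).resolve_left hD3
    have huv : (3 : ℤ) ∣ u + v := by
      obtain ⟨z, hz⟩ := hN
      exact p3.dvd_of_dvd_pow (n := 2) ⟨z + u * v, by linear_combination hz⟩
    obtain ⟨z, hz⟩ := hN
    obtain ⟨j, hj⟩ := huv
    have hu : u = 3 * j - v := by linarith
    have hv : (3 : ℤ) ∣ v := by
      have : (3 : ℤ) ∣ D * (v ^ 3 * h) := by
        subst hu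
        have e27 : ∃ y, (( (3 * j - v) ^ 3 + v ^ 3 - 3 * (3 * j - v) * v ^ 2) * (2 * g - h)
          - (3 * (3 * j - v) ^ 2 * v - 3 * (3 * j - v) * v ^ 2) * (g + h)) =
            27 * y - 9 * v ^ 3 * h :=
          ⟨(j ^ 3 - j ^ 2 * v) * (2 * g - h) - (j ^ 2 * v - j * v ^ 2) * (g + h), by ring⟩
        obtain ⟨y, hy⟩ := e27
        rw [hy, hz] at hq
        refine ⟨w' ^ 3 - D * z * w' + D * y - q, ?_⟩
        apply mul_left_cancel₀ (show (9 : ℤ) ≠ 0 by norm_num)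
        linear_combination (-1) * hq
      exact p3.dvd_of_dvd_pow ((p3.dvd_or_dvd ((p3.dvd_or_dvd this).resolve_left hD3)).resolve_right hh)
    exact ⟨by omega, hv, Dvd.intro _ rfl⟩
  · exfalso
    have hN : ¬ (3 : ℤ) ∣ u ^ 2 - u * v + v ^ 2 := by
      rintro ⟨z, hz⟩
      rw [hz] at hr
      exact hw (p3.dvd_of_dvd_pow (n := 2) ⟨r + D * z, by linarith⟩)
    have huv : ¬ (3 : ℤ) ∣ u + v := by
      rintro ⟨z, hz⟩
      exact hN ⟨3 * z ^ 2 - u * v, by linear_combination (u + v + 3 * z) * hz⟩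
    obtain ⟨N1, hN1⟩ := c3_norm_mod3 u v hN
    have hY : ∃ b, 3 * u ^ 2 * v - 3 * u * v ^ 2 = 9 * b := by
      have : (3 : ℤ) ∣ u ∨ (3 : ℤ) ∣ v ∨ (3 : ℤ) ∣ u - v := by
        rcases (by omega : u % 3 = 0 ∨ u % 3 = 1 ∨ u % 3 = 2) with k | k | k <;>
        rcases (by omega : v % 3 = 0 ∨ v % 3 = 1 ∨ v % 3 = 2) with l | l | l <;> omega
      rcases this with ⟨z, hz⟩ | ⟨z, hz⟩ | ⟨z, hz⟩
      · exact ⟨z * v * (u - v), by linear_combination 3 * v * (u - v) * hz⟩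
      · exact ⟨z * u * (u - v), by linear_combination 3 * u * (u - v) * hz⟩
      · exact ⟨u * v * z, by linear_combination 3 * u * v * hz⟩
    obtain ⟨b, hb⟩ := hY
    have hX : ∃ a, (u ^ 3 + v ^ 3 - 3 * u * v ^ 2) ^ 2 = 9 * a + 1 := by
      have : (u ^ 3 + v ^ 3 - 3 * u * v ^ 2) ^ 2 =
        (u ^ 2 - u * v + v ^ 2) ^ 3 + (u ^ 3 + v ^ 3 - 3 * u * v ^ 2) *
          (3 * u ^ 2 * v - 3 * u * v ^ 2) - (3 * u ^ 2 * v - 3 * u * v ^ 2) ^ 2 := by ring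
      rw [this, hN1, hb]
      exact ⟨3 * N1 ^ 3 + 3 * N1 ^ 2 + N1 + (u ^ 3 + v ^ 3 - 3 * u * v ^ 2) * b - 9 * b ^ 2, by ring⟩
    obtain ⟨a, ha⟩ := hX
    have hw6 : ∃ y, (w ^ 3) ^ 2 = 9 * y + 1 := by
      obtain ⟨j, rfl | rfl⟩ := c3_mod3 w hw
      · exact ⟨81 * j ^ 6 + 162 * j ^ 5 + 135 * j ^ 4 + 60 * j ^ 3 + 15 * j ^ 2 + 2 * j, by ring⟩
      · exact ⟨81 * j ^ 6 - 162 * j ^ 5 + 135 * j ^ 4 - 60 * j ^ 3 + 15 * j ^ 2 - 2 * j, by ring⟩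
    obtain ⟨y, hy⟩ := hw6
    set X := u ^ 3 + v ^ 3 - 3 * u * v ^ 2
    rw [hb] at hq
    have hq2 : ∃ m, D * (X * (2 * g - h)) = 2 * w ^ 3 + 9 * m :=
      ⟨3 * q + D * b * (g + h) - r * w, by linear_combination hq - w * hr⟩
    obtain ⟨m, hm⟩ := hq2
    have hs : D ^ 2 * X ^ 2 * (4 * D - 3 * h ^ 2) = (2 * w ^ 3 + 9 * m) ^ 2 := by
      rw [← hm, ← hD]; ring
    have h3h : (3 : ℤ) ∣ h ^ 2 := by
      have e1 : (2 * w ^ 3 + 9 * m) ^ 2 = 4 * (9 * y + 1) + 9 * (4 * w ^ 3 * m + 9 * m ^ 2) := by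
        rw [← hy]; ring
      rw [e1, ha, hD1] at hs
      generalize 4 * w ^ 3 * m + 9 * m ^ 2 = W at hs
      have e2 : ∃ s, (3 * D1 + 1) ^ 2 * (9 * a + 1) * (4 * (3 * D1 + 1) - 3 * h ^ 2) =
          9 * s + 4 - 3 * h ^ 2 :=
        ⟨(3 * D1 + 1) ^ 2 * a * (4 * (3 * D1 + 1) - 3 * h ^ 2) +
          (12 * D1 ^ 3 + 12 * D1 ^ 2 + 4 * D1) - (3 * D1 ^ 2 + 2 * D1) * h ^ 2, by ring⟩
      obtain ⟨s, hs2⟩ := e2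
      rw [hs2] at hs
      omega
    exact hh (p3.dvd_of_dvd_pow h3h)

theorem c3_dvd (n a₀ a₁ : ℤ) (hdvd : ((a₀ : AdjoinRoot (X ^ 2 + X + 1 : ℤ[X])) +
        (a₁ : AdjoinRoot (X ^ 2 + X + 1 : ℤ[X])) * AdjoinRoot.root _) ∣
        ((n : AdjoinRoot (X ^ 2 + X + 1 : ℤ[X])) + 3 + 3 * AdjoinRoot.root _)) :
    (a₀ ^ 2 - a₀ * a₁ + a₁ ^ 2) ∣ 3 * a₀ - (n + 3) * a₁ := by
  let w : QuadraticAlgebra ℤ (-1) (-1) := ⟨0, 1⟩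
  have hw : (X ^ 2 + X + 1 : ℤ[X]).eval₂ (Int.castRingHom _) w = 0 := by
    simp only [eval₂_add, eval₂_pow, eval₂_X, eval₂_one]
    ext <;> simp [w, pow_two, QuadraticAlgebra.re_one, QuadraticAlgebra.im_one]
  let φ := AdjoinRoot.lift (Int.castRingHom _) w hw
  have h := map_dvd φ hdvd
  have h3 : φ 3 = 3 := map_ofNat φ 3
  have hr : φ (AdjoinRoot.root _) = w := AdjoinRoot.lift_root hw
  simp only [map_add, map_mul, map_intCast, h3, hr] at h
  obtain ⟨b, hb⟩ := h
  have e1 := congrArg QuadraticAlgebra.re hb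
  have e2 := congrArg QuadraticAlgebra.im hb
  simp [w, QuadraticAlgebra.re_ofNat, QuadraticAlgebra.im_ofNat] at e1 e2
  exact ⟨b.im, by linear_combination a₀ * e2 - a₁ * e1⟩

theorem c3_setup (n : ℤ) (hn : n % 9 = 3) (hn27 : ¬ n % 27 = 12)
    (d e c : ℤ) 
    (hsqd : Squarefree d) (hsqe : Squarefree e) (hde : IsCoprime d e)
    (he : e ≠ 0) (hc : c ≠ 0)
    (hΔ : n ^ 2 + 3 * n + 9 = d * e ^ 2 * c ^ 3)
    (a₀ a₁ : ℤ) (hec : e * c = a₀ ^ 2 - a₀ * a₁ + a₁ ^ 2)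
    (hdvd : e * c ∣ 3 * a₀ - (n + 3) * a₁) :
    ∃ k C g h : ℤ, n = 9 * k + 3 ∧ c = 3 * C ∧ 3 * k ^ 2 + 3 * k + 1 = d * e ^ 2 * C ^ 3 ∧
      ¬ (3 : ℤ) ∣ d * e ∧ ¬ (3 : ℤ) ∣ h ∧ g ^ 2 - g * h + h ^ 2 = d * e ∧
      (3 * k + 1) * (a₀ ^ 3 + a₁ ^ 3 - 3 * a₀ * a₁ ^ 2) + (3 * a₀ ^ 2 * a₁ - 3 * a₀ * a₁ ^ 2) =
        9 * e ^ 2 * C ^ 3 * g ∧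
      (3 * k + 2) * (3 * a₀ ^ 2 * a₁ - 3 * a₀ * a₁ ^ 2) - (a₀ ^ 3 + a₁ ^ 3 - 3 * a₀ * a₁ ^ 2) =
        9 * e ^ 2 * C ^ 3 * h := by
  have p3 : Prime (3 : ℤ) := Int.prime_three
  have u3 : ¬ IsUnit (3 : ℤ) := p3.not_isUnit
  obtain ⟨k, rfl⟩ : ∃ k, n = 9 * k + 3 := ⟨n / 9, by omega⟩
  have hc3 : (3 : ℤ) ∣ c := by
    by_contra hc3
    have h27 : (3 : ℤ) ^ 3 ∣ d * e ^ 2 := by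
      have : (3 : ℤ) ^ 3 ∣ d * e ^ 2 * c ^ 3 := ⟨3 * k ^ 2 + 3 * k + 1, by rw [← hΔ]; ring⟩
      exact IsCoprime.dvd_of_dvd_mul_right
        (IsCoprime.pow ((Prime.coprime_iff_not_dvd p3).2 hc3)) this
    by_cases h3e : (3 : ℤ) ∣ e
    · have h3d : ¬ (3 : ℤ) ∣ d := fun h => u3 (hde.isUnit_of_dvd' h h3e)
      have : (3 : ℤ) ^ 3 ∣ e ^ 2 := IsCoprime.dvd_of_dvd_mul_left
        (IsCoprime.pow_left ((Prime.coprime_iff_not_dvd p3).2 h3d)) h27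
      obtain ⟨e1, rfl⟩ := h3e
      have : (3 : ℤ) ∣ e1 ^ 2 := by
        obtain ⟨q, hq⟩ := this
        exact ⟨q, by linarith⟩
      obtain ⟨e2, rfl⟩ := p3.dvd_of_dvd_pow this
      exact u3 (hsqe 3 ⟨e2, by ring⟩)
    · have : (3 : ℤ) ^ 3 ∣ d := IsCoprime.dvd_of_dvd_mul_right
        (IsCoprime.pow ((Prime.coprime_iff_not_dvd p3).2 h3e)) h27
      exact u3 (hsqd 3 (dvd_trans ⟨3, by norm_num⟩ this))
  obtain ⟨C, rfl⟩ := hc3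
  have hC : C ≠ 0 := by rintro rfl; simp at hc
  have R1 : 3 * k ^ 2 + 3 * k + 1 = d * e ^ 2 * C ^ 3 := by linarith
  have n3 : ¬ (3 : ℤ) ∣ d * e ^ 2 * C ^ 3 := by rw [← R1]; omega
  have n3d : ¬ (3 : ℤ) ∣ d * e := fun h => n3 (by
    obtain ⟨q, hq⟩ := h; exact ⟨q * e * C ^ 3, by linear_combination e * C ^ 3 * hq⟩)
  have n3e : ¬ (3 : ℤ) ∣ e * C := fun h => n3 (by
    obtain ⟨q, hq⟩ := h; exact ⟨q * d * e * C ^ 2, by linear_combination d * e * C ^ 2 * hq⟩)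
  have h01 : (3 : ℤ) ∣ a₀ + a₁ :=
    p3.dvd_of_dvd_pow (n := 2) ⟨e * C + a₀ * a₁, by linear_combination -hec⟩
  have n3a : ¬ (3 : ℤ) ∣ a₁ := by
    intro h
    obtain ⟨x, hx⟩ := h
    obtain ⟨y, hy⟩ : (3 : ℤ) ∣ a₀ := by omega
    rw [hx, hy] at hec
    exact n3e ⟨y ^ 2 - y * x + x ^ 2, by linarith⟩
  have ht : ∃ t, a₀ = (3 * k + 2) * a₁ + 3 * e * C * t := by
    obtain ⟨q, hq⟩ := hdvd
    have h1 : a₀ - (3 * k + 2) * a₁ = e * C * q := by linarith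
    have h2 : (3 : ℤ) ∣ e * C * q := by
      rw [← h1]
      obtain ⟨z, hz⟩ := h01
      exact ⟨z - (k + 1) * a₁, by linear_combination hz⟩
    obtain ⟨t, rfl⟩ := (p3.dvd_or_dvd h2).resolve_left n3e
    exact ⟨t, by linear_combination h1⟩
  obtain ⟨t, ht⟩ := ht
  have E1 : (3 * k + 1) * (a₀ ^ 3 + a₁ ^ 3 - 3 * a₀ * a₁ ^ 2) + (3 * a₀ ^ 2 * a₁ - 3 * a₀ * a₁ ^ 2) =
        9 * e ^ 2 * C ^ 3 * (a₁ ^ 3 * d * (3 * k ^ 2 + 4 * k + 1) +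
          3 * a₁ ^ 2 * t * d * e * C * (3 * k + 2) + 9 * a₁ * t ^ 2 * d * e ^ 2 * C ^ 2 +
          3 * e * t ^ 3 * (3 * k + 1)) := by
    rw [ht]
    linear_combination 3 * (a₁ ^ 3 * ((3 * k + 2) ^ 2 - 1) + 9 * a₁ ^ 2 * (3 * k + 2) * e * C * t
      + 27 * a₁ * e ^ 2 * C ^ 2 * t ^ 2) * R1
  have E2 : (3 * k + 2) * (3 * a₀ ^ 2 * a₁ - 3 * a₀ * a₁ ^ 2) - (a₀ ^ 3 + a₁ ^ 3 - 3 * a₀ * a₁ ^ 2) =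
        9 * e ^ 2 * C ^ 3 * (a₁ ^ 3 * d * (2 * k + 1) +
          3 * a₁ ^ 2 * t * d * e * C - 3 * e * t ^ 3) := by
    rw [ht]
    linear_combination 3 * (a₁ ^ 3 * (6 * k + 3) + 9 * a₁ ^ 2 * e * C * t) * R1
  refine ⟨k, C, _, _, rfl, rfl, R1, n3d, ?_, ?_, E1, E2⟩
  · intro h
    have : (3 : ℤ) ∣ a₁ ^ 3 * d * (2 * k + 1) := by
      obtain ⟨q, hq⟩ := h
      exact ⟨q - a₁ ^ 2 * t * d * e * C + e * t ^ 3, by linear_combination hq⟩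
    rcases p3.dvd_or_dvd this with h | h
    · rcases p3.dvd_or_dvd h with h | h
      · exact n3a (p3.dvd_of_dvd_pow h)
      · exact n3d (Dvd.dvd.mul_right h _)
    · omega
  · generalize (a₁ ^ 3 * d * (3 * k ^ 2 + 4 * k + 1) +
          3 * a₁ ^ 2 * t * d * e * C * (3 * k + 2) + 9 * a₁ * t ^ 2 * d * e ^ 2 * C ^ 2 +
          3 * e * t ^ 3 * (3 * k + 1)) = g at E1 ⊢
    generalize (a₁ ^ 3 * d * (2 * k + 1) +
          3 * a₁ ^ 2 * t * d * e * C - 3 * e * t ^ 3) = h at E2 ⊢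
    apply mul_left_cancel₀ (show 81 * e ^ 4 * C ^ 6 ≠ 0 by positivity)
    have : 81 * e ^ 4 * C ^ 6 * (g ^ 2 - g * h + h ^ 2) = 
      (9 * e ^ 2 * C ^ 3 * g) ^ 2 - (9 * e ^ 2 * C ^ 3 * g) * (9 * e ^ 2 * C ^ 3 * h)
      + (9 * e ^ 2 * C ^ 3 * h) ^ 2 := by ring
    rw [this, ← E1, ← E2]
    have : 81 * e ^ 4 * C ^ 6 * (d * e) = (3 * (d * e ^ 2 * C ^ 3)) * (e * (3 * C)) ^ 3 := by ring
    rw [this, hec, ← R1]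
    ring

theorem c3_int_dvd {K : Type*} [Field K] [CharZero K] (y : K) (hy : IsIntegral ℤ y) (p q : ℤ)
    (hp : p ≠ 0) (h : (p : K) * y = q) : p ∣ q := by
  have hp' : (p : K) ≠ 0 := by exact_mod_cast hp
  have e : y = algebraMap ℚ K ((q : ℚ) / p) := by
    rw [map_div₀, map_intCast, map_intCast, eq_div_iff hp', ← h]; ring
  rw [e, isIntegral_algebraMap_iff (algebraMap ℚ K).injective] at hy
  obtain ⟨z, hz⟩ := IsIntegrallyClosed.isIntegral_iff.1 hy
  refine ⟨z, ?_⟩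
  have hpq : (p : ℚ) ≠ 0 := by exact_mod_cast hp
  rw [eq_div_iff hpq] at hz
  have : (q : ℚ) = p * z := by rw [← hz]; simp [mul_comm]
  exact_mod_cast this

theorem c3_cubic_int {K : Type*} [Field K] (x : K) (a b : ℤ) (h : x ^ 3 + a * x - b = 0) :
    IsIntegral ℤ x := by
  refine ⟨X ^ 3 + C a * X - C b, ?_, ?_⟩
  · monicity!
  · simp only [eval₂_add, eval₂_sub, eval₂_mul, eval₂_pow, eval₂_X, eval₂_C]
    simp only [eq_intCast]
    exact h

theorem c3_sigma {K : Type*} [Field K] [NumberField K] (n : ℤ) (ρ ρ' : K)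
    (hρ : ρ ^ 3 - (n : K) * ρ ^ 2 - ((n : K) + 3) * ρ - 1 = 0)
    (hρ' : ρ' ^ 3 - (n : K) * ρ' ^ 2 - ((n : K) + 3) * ρ' - 1 = 0)
    (hgen : Algebra.adjoin ℚ {ρ} = ⊤) : ∃ σ : K →ₐ[ℚ] K, σ ρ = ρ' := by
  set F : ℤ[X] := X ^ 3 - C n * X ^ 2 - C (n + 3) * X - 1 with hF
  have hFm : F.Monic := by rw [hF]; monicity!
  have hFd : F.natDegree = 3 := by rw [hF]; compute_degree!
  set f : ℚ[X] := F.map (Int.castRingHom ℚ) with hf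
  have hfm : f.Monic := hFm.map _
  have hfd : f.natDegree = 3 := by rw [hf, hFm.natDegree_map, hFd]
  have hfx : ∀ x : K, aeval x f = x ^ 3 - (n : K) * x ^ 2 - ((n : K) + 3) * x - 1 := by
    intro x
    have : aeval x f = aeval x F := by rw [hf]; exact aeval_map_algebraMap ℚ x F
    rw [this, hF]
    simp only [map_sub, map_mul, map_pow, aeval_X, map_one, map_add, map_ofNat,
      eq_intCast, map_intCast]
  have hirr : Irreducible f := by
    apply irreducible_of_degree_le_three_of_not_isRoot
    · rw [hfd]; decide
    · intro x hx
      have hx' : aeval x F = 0 := by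
        rw [IsRoot, hf, eval_map] at hx
        exact hx
      obtain ⟨r, hr⟩ := isInteger_of_is_root_of_monic hFm hx'
      rw [← hr] at hx'
      have h0 : r ^ 3 - n * r ^ 2 - (n + 3) * r - 1 = 0 := by
        simp only [hF, map_sub, map_mul, map_pow, aeval_X, map_one, map_add, map_ofNat,
          eq_intCast, map_intCast] at hx'
        exact_mod_cast hx'
      have h1 := congrArg (fun z : ℤ => (z : ZMod 2)) h0
      push_cast at h1
      generalize (r : ZMod 2) = r2 at h1
      generalize (n : ZMod 2) = n2 at h1
      revert h1 r2 n2
      decide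
  have hmin : minpoly ℚ ρ = f :=
    (minpoly.eq_of_irreducible_of_monic hirr (by rw [hfx, hρ]) hfm).symm
  have hint : IsIntegral ℚ ρ := Algebra.IsIntegral.isIntegral ρ
  let pb := PowerBasis.ofAdjoinEqTop hint hgen
  have hpg : pb.gen = ρ := PowerBasis.ofAdjoinEqTop_gen hint hgen
  refine ⟨pb.lift ρ' (by rw [hpg, hmin, hfx, hρ']), ?_⟩
  have := pb.lift_gen ρ' (by rw [hpg, hmin, hfx, hρ'])
  exact (congrArg _ hpg.symm).trans this

theorem c3_span {K : Type*} [Field K] [NumberField K] (n : ℤ) (ρ : K)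
    (hρ : ρ ^ 3 - (n : K) * ρ ^ 2 - ((n : K) + 3) * ρ - 1 = 0)
    (hgen : Algebra.adjoin ℚ {ρ} = ⊤) (x : K) :
    ∃ N : ℕ, N ≠ 0 ∧ ∃ b₀ b₁ b₂ : ℤ, (N : K) * x = b₀ + b₁ * ρ + b₂ * ρ ^ 2 := by
  have hx : x ∈ Algebra.adjoin ℚ {ρ} := by rw [hgen]; trivial
  induction hx using Algebra.adjoin_induction with
  | mem y hy =>
    rw [Set.mem_singleton_iff.1 hy]
    exact ⟨1, one_ne_zero, 0, 1, 0, by simp⟩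
  | algebraMap r =>
    refine ⟨r.den, r.den_ne_zero, r.num, 0, 0, ?_⟩
    have : (r.den : ℚ) * r = r.num := by rw [mul_comm]; exact Rat.mul_den_eq_num r
    have := congrArg (algebraMap ℚ K) this
    rw [map_mul, map_natCast, map_intCast] at this
    rw [this]; simp
  | add x y _ _ hx hy =>
    obtain ⟨N, hN, b₀, b₁, b₂, hb⟩ := hx
    obtain ⟨M, hM, c₀, c₁, c₂, hc⟩ := hy
    refine ⟨N * M, mul_ne_zero hN hM, M * b₀ + N * c₀, M * b₁ + N * c₁, M * b₂ + N * c₂, ?_⟩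
    push_cast
    linear_combination M * hb + N * hc
  | mul x y _ _ hx hy =>
    obtain ⟨N, hN, b₀, b₁, b₂, hb⟩ := hx
    obtain ⟨M, hM, c₀, c₁, c₂, hc⟩ := hy
    refine ⟨N * M, mul_ne_zero hN hM,
      b₀ * c₀ + (b₁ * c₂ + b₂ * c₁) + b₂ * c₂ * n,
      b₀ * c₁ + b₁ * c₀ + (b₁ * c₂ + b₂ * c₁) * (n + 3) + b₂ * c₂ * (n * (n + 3) + 1),
      b₀ * c₂ + b₁ * c₁ + b₂ * c₀ + (b₁ * c₂ + b₂ * c₁) * n + b₂ * c₂ * (n ^ 2 + n + 3), ?_⟩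
    push_cast
    linear_combination M * y * hb + (b₀ + b₁ * ρ + b₂ * ρ ^ 2) * hc +
      (b₁ * c₂ + b₂ * c₁ + b₂ * c₂ * (ρ + n)) * hρ

/-- Norm identity for the basic elements. -/
theorem c3_norm {K : Type*} [Field K] (n Δ b b' b'' U V W : K)
    (h1 : b + b' + b'' = 0) (h2 : b * b' + b' * b'' + b'' * b = -3 * Δ)
    (h3 : b * b' * b'' = (2 * n + 3) * Δ)
    (h4 : b ^ 2 * b' + b' ^ 2 * b'' + b'' ^ 2 * b = (9 - 3 * n) * Δ) :
    (U * b + V * b' + W) * (U * b' + V * b'' + W) * (U * b'' + V * b + W) =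
      W ^ 3 - 3 * Δ * (U ^ 2 - U * V + V ^ 2) * W +
      Δ * ((U ^ 3 + V ^ 3 - 3 * U * V ^ 2) * (2 * n + 3)
        - (3 * U ^ 2 * V - 3 * U * V ^ 2) * (n - 3)) := by
  linear_combination (W ^ 2 * (U + V) + W * U * V * (b + b' + b'') +
    U * V ^ 2 * (b * b' + b' * b'' + b'' * b)) * h1 + W * (U ^ 2 - U * V + V ^ 2) * h2 +
    (U ^ 3 + V ^ 3 - 3 * U * V ^ 2) * h3 + (U ^ 2 * V - U * V ^ 2) * h4

theorem c3_pair {K : Type*} [Field K] (Δ b b' b'' U V W : K)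
    (h1 : b + b' + b'' = 0) (h2 : b * b' + b' * b'' + b'' * b = -3 * Δ) :
    (U * b + V * b' + W) * (U * b' + V * b'' + W) + (U * b' + V * b'' + W) * (U * b'' + V * b + W)
     + (U * b'' + V * b + W) * (U * b + V * b' + W) =
      3 * W ^ 2 - 3 * Δ * (U ^ 2 - U * V + V ^ 2) := by
  linear_combination (2 * W * (U + V) + U * V * (b + b' + b'')) * h1 + (U ^ 2 - U * V + V ^ 2) * h2


theorem c3_alpha {K : Type*} [Field K] (k d e C g h a₀ a₁ b b' b'' α α' α'' : K)
    (h1 : b + b' + b'' = 0)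
    (h2 : b * b' + b' * b'' + b'' * b = -3 * (27 * d * e ^ 2 * C ^ 3))
    (h3 : b * b' * b'' = (2 * (9 * k + 3) + 3) * (27 * d * e ^ 2 * C ^ 3))
    (h4 : b ^ 2 * b' + b' ^ 2 * b'' + b'' ^ 2 * b =
      (9 - 3 * (9 * k + 3)) * (27 * d * e ^ 2 * C ^ 3))
    (hN : a₀ ^ 2 - a₀ * a₁ + a₁ ^ 2 = 3 * e * C)
    (E1 : (3 * k + 1) * (a₀ ^ 3 + a₁ ^ 3 - 3 * a₀ * a₁ ^ 2) +
      (3 * a₀ ^ 2 * a₁ - 3 * a₀ * a₁ ^ 2) = 9 * e ^ 2 * C ^ 3 * g)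
    (E2 : (3 * k + 2) * (3 * a₀ ^ 2 * a₁ - 3 * a₀ * a₁ ^ 2) -
      (a₀ ^ 3 + a₁ ^ 3 - 3 * a₀ * a₁ ^ 2) = 9 * e ^ 2 * C ^ 3 * h)
    (hs : 9 * e * C ^ 2 ≠ 0)
    (hα : 9 * e * C ^ 2 * α = a₀ * b + a₁ * b')
    (hα' : 9 * e * C ^ 2 * α' = a₀ * b' + a₁ * b'')
    (hα'' : 9 * e * C ^ 2 * α'' = a₀ * b'' + a₁ * b) (u v w : K) :
    (u * α + v * α' + w) + (u * α' + v * α'' + w) + (u * α'' + v * α + w) = 3 * w ∧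
    (u * α + v * α' + w) * (u * α' + v * α'' + w) + (u * α' + v * α'' + w) * (u * α'' + v * α + w)
     + (u * α'' + v * α + w) * (u * α + v * α' + w) =
      3 * w ^ 2 - 3 * (d * e) * (u ^ 2 - u * v + v ^ 2) ∧
    (u * α + v * α' + w) * (u * α' + v * α'' + w) * (u * α'' + v * α + w) =
      w ^ 3 - 3 * (d * e) * (u ^ 2 - u * v + v ^ 2) * w +
      (d * e) * ((u ^ 3 + v ^ 3 - 3 * u * v ^ 2) * (2 * g - h)
        - (3 * u ^ 2 * v - 3 * u * v ^ 2) * (g + h)) := by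
  have x1 : 9 * e * C ^ 2 * (u * α + v * α' + w) =
      (u * a₀ - v * a₁) * b + (u * a₁ + v * a₀ - v * a₁) * b' + 9 * e * C ^ 2 * w := by
    linear_combination u * hα + v * hα' + v * a₁ * h1
  have x2 : 9 * e * C ^ 2 * (u * α' + v * α'' + w) =
      (u * a₀ - v * a₁) * b' + (u * a₁ + v * a₀ - v * a₁) * b'' + 9 * e * C ^ 2 * w := by
    linear_combination u * hα' + v * hα'' + v * a₁ * h1
  have x3 : 9 * e * C ^ 2 * (u * α'' + v * α + w) =
      (u * a₀ - v * a₁) * b'' + (u * a₁ + v * a₀ - v * a₁) * b + 9 * e * C ^ 2 * w := by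
    linear_combination u * hα'' + v * hα + v * a₁ * h1
  generalize u * α + v * α' + w = z1 at *
  generalize u * α' + v * α'' + w = z2 at *
  generalize u * α'' + v * α + w = z3 at *
  refine ⟨?_, ?_, ?_⟩
  · apply mul_left_cancel₀ hs
    linear_combination x1 + x2 + x3 + (u * a₀ - v * a₁ + u * a₁ + v * a₀ - v * a₁) * h1
  · apply mul_left_cancel₀ (pow_ne_zero 2 hs)
    have := c3_pair (27 * d * e ^ 2 * C ^ 3) b b' b'' (u * a₀ - v * a₁) (u * a₁ + v * a₀ - v * a₁)
      (9 * e * C ^ 2 * w) h1 h2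
    rw [← x1, ← x2, ← x3] at this
    linear_combination this - 3 * (27 * d * e ^ 2 * C ^ 3) * (u ^ 2 - u * v + v ^ 2) * hN
  · apply mul_left_cancel₀ (pow_ne_zero 3 hs)
    have := c3_norm (9 * k + 3) (27 * d * e ^ 2 * C ^ 3) b b' b'' (u * a₀ - v * a₁)
      (u * a₁ + v * a₀ - v * a₁) (9 * e * C ^ 2 * w) h1 h2 h3 h4
    rw [← x1, ← x2, ← x3] at this
    linear_combination this -
      3 * (27 * d * e ^ 2 * C ^ 3) * (u ^ 2 - u * v + v ^ 2) * (9 * e * C ^ 2 * w) * hN +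
      (27 * d * e ^ 2 * C ^ 3) * 3 *
       ((2 * (u ^ 3 + v ^ 3 - 3 * u * v ^ 2) - (3 * u ^ 2 * v - 3 * u * v ^ 2)) * E1 -
        ((u ^ 3 + v ^ 3 - 3 * u * v ^ 2) + (3 * u ^ 2 * v - 3 * u * v ^ 2)) * E2)

theorem ring_of_integers_decomposition_case3
    (n : ℤ) (hn : n % 9 = 3) (hn27 : ¬ n % 27 = 12)
    {K : Type*} [Field K] [NumberField K]
    (ρ ρ' ρ'' : K)
    (hρ : ρ ^ 3 - (n : K) * ρ ^ 2 - ((n : K) + 3) * ρ - 1 = 0)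
    (h1 : 1 + ρ ≠ 0) (hρ' : ρ' = -1 / (1 + ρ))
    (h1' : 1 + ρ' ≠ 0) (hρ'' : ρ'' = -1 / (1 + ρ'))
    (hgen : Algebra.adjoin ℚ {ρ} = ⊤)
    (d e c : ℤ) (hd : 0 < d) (he : 0 < e) (hc : 0 < c)
    (hsqd : Squarefree d) (hsqe : Squarefree e) (hde : IsCoprime d e)
    (hΔ : n ^ 2 + 3 * n + 9 = d * e ^ 2 * c ^ 3)
    (a₀ a₁ : ℤ) (hec : e * c = a₀ ^ 2 - a₀ * a₁ + a₁ ^ 2)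
    (hdvd : ((a₀ : AdjoinRoot (X ^ 2 + X + 1 : ℤ[X])) +
        (a₁ : AdjoinRoot (X ^ 2 + X + 1 : ℤ[X])) * AdjoinRoot.root _) ∣
        ((n : AdjoinRoot (X ^ 2 + X + 1 : ℤ[X])) + 3 + 3 * AdjoinRoot.root _))
    (α α' α'' : K)
    (hα : α = (3 * a₀ * ρ + 3 * a₁ * ρ' - n * (a₀ + a₁)) / (e * c ^ 2))
    (hα' : α' = (3 * a₀ * ρ' + 3 * a₁ * ρ'' - n * (a₀ + a₁)) / (e * c ^ 2))
    (hα'' : α'' = (3 * a₀ * ρ'' + 3 * a₁ * ρ - n * (a₀ + a₁)) / (e * c ^ 2)) :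
    IsIntegral ℤ α ∧
    Submodule.span ℤ {α, α', α''} ⊔ Submodule.span ℤ {(1 : K)} =
      Subalgebra.toSubmodule (integralClosure ℤ K) ∧
    Submodule.span ℤ {α, α', α''} ⊓ Submodule.span ℤ {(1 : K)} = ⊥ := by
  have K0 : CharZero K := inferInstance
  have he' : e ≠ 0 := he.ne'
  have hc' : c ≠ 0 := hc.ne'
  have hdv := c3_dvd n a₀ a₁ hdvd
  rw [← hec] at hdv
  obtain ⟨k, C, g, h, hnk, hcC, R1, n3d, n3h, hgh, E1, E2⟩ := c3_setup n hn hn27 d e c hsqd hsqe hde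
    he' hc' hΔ a₀ a₁ hec hdv
  subst hcC
  have hC : C ≠ 0 := by rintro rfl; simp at hc
  have hsqD : Squarefree (d * e) := (squarefree_mul_iff).2 ⟨hde.isRelPrime, hsqd, hsqe⟩
  have eK : (e : K) ≠ 0 := by exact_mod_cast he'
  have CK : (C : K) ≠ 0 := by exact_mod_cast hC
  have s0 : 9 * (e : K) * C ^ 2 ≠ 0 := by
    have : (9 : K) ≠ 0 := by norm_num
    positivity
  have r1 : ρ' * (1 + ρ) = -1 := by rw [hρ']; field_simp
  have r2 : ρ'' * (1 + ρ') = -1 := by rw [hρ'']; field_simp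
  have r3 : ρ * (1 + ρ'') = -1 := by
    apply mul_left_cancel₀ h1'
    linear_combination ρ * r2 + r1
  have h1'' : 1 + ρ'' ≠ 0 := by
    intro h0; rw [h0] at r3; simp at r3
  -- quadratic expression of the conjugate
  have q1 : ρ' = ρ ^ 2 - (n + 1) * ρ - 2 := by
    apply mul_left_cancel₀ h1
    linear_combination r1 - hρ
  have ρ0 : ρ ≠ 0 := by rintro h0; rw [h0] at r3; simp at r3
  have q2 : ρ'' = n - ρ - ρ' := by
    apply mul_left_cancel₀ ρ0
    rw [q1]
    linear_combination r3 + hρ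
  have hρ1 : ρ' ^ 3 - (n : K) * ρ' ^ 2 - ((n : K) + 3) * ρ' - 1 = 0 := by
    apply mul_left_cancel₀ (pow_ne_zero 3 h1)
    have e1 : (1 + ρ) ^ 3 * (ρ' ^ 3 - (n : K) * ρ' ^ 2 - ((n : K) + 3) * ρ' - 1) =
      (ρ' * (1 + ρ)) ^ 3 - n * (ρ' * (1 + ρ)) ^ 2 * (1 + ρ)
        - (n + 3) * (ρ' * (1 + ρ)) * (1 + ρ) ^ 2 - (1 + ρ) ^ 3 := by ring
    rw [e1, r1]
    linear_combination -hρ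
  obtain ⟨σ, hσ⟩ := c3_sigma n ρ ρ' hρ hρ1 hgen
  have hσ' : σ ρ' = ρ'' := by
    rw [hρ', hρ'', map_div₀, map_neg, map_one, map_add, map_one, hσ]
  have hσ'' : σ ρ'' = ρ := by
    rw [hρ'', map_div₀, map_neg, map_one, map_add, map_one, hσ', div_eq_iff h1'', r3]
  have sα : σ α = α' := by
    rw [hα, hα']
    simp only [map_div₀, map_sub, map_add, map_mul, map_pow, map_intCast, map_ofNat, hσ, hσ']
  have sα' : σ α' = α'' := by
    rw [hα', hα'']
    simp only [map_div₀, map_sub, map_add, map_mul, map_pow, map_intCast, map_ofNat, hσ', hσ'']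
  have sα'' : σ α'' = α := by
    rw [hα, hα'']
    simp only [map_div₀, map_sub, map_add, map_mul, map_pow, map_intCast, map_ofNat, hσ, hσ'']
  have nK : (n : K) = 9 * k + 3 := by rw [hnk]; push_cast; ring
  have ΔK : (n : K) ^ 2 + 3 * n + 9 = 27 * d * e ^ 2 * C ^ 3 := by
    have : n ^ 2 + 3 * n + 9 = 27 * d * e ^ 2 * C ^ 3 := by rw [hΔ]; ring
    exact_mod_cast this
  have t1 : ρ + ρ' + ρ'' = n := by rw [q2]; ring
  have t2 : ρ * ρ' + ρ' * ρ'' + ρ'' * ρ = -(n + 3) := by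
    linear_combination r1 + r2 + r3 - t1
  have t3 : ρ * ρ' * ρ'' = 1 := by linear_combination ρ' * r3 - r1
  have t4 : ρ ^ 2 * ρ' + ρ' ^ 2 * ρ'' + ρ'' ^ 2 * ρ = 3 := by
    linear_combination ρ * r1 + ρ' * r2 + ρ'' * r3 - t1 - t2
  have hNK : (a₀ : K) ^ 2 - a₀ * a₁ + a₁ ^ 2 = 3 * e * C := by
    have : a₀ ^ 2 - a₀ * a₁ + a₁ ^ 2 = 3 * e * C := by rw [← hec]; ring
    exact_mod_cast this
  have m1 : 9 * (e : K) * C ^ 2 * α = a₀ * (3 * ρ - n) + a₁ * (3 * ρ' - n) := by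
    rw [hα]; push_cast; field_simp; ring
  have m2 : 9 * (e : K) * C ^ 2 * α' = a₀ * (3 * ρ' - n) + a₁ * (3 * ρ'' - n) := by
    rw [hα']; push_cast; field_simp; ring
  have m3 : 9 * (e : K) * C ^ 2 * α'' = a₀ * (3 * ρ'' - n) + a₁ * (3 * ρ - n) := by
    rw [hα'']; push_cast; field_simp; ring
  have key := fun u v w : K => c3_alpha (k : K) d e C g h a₀ a₁ (3 * ρ - n) (3 * ρ' - n) (3 * ρ'' - n)
    α α' α''
    (by rw [q2]; ring)
    (by rw [← ΔK, q2, q1]; linear_combination (-9) * (ρ - n - 1) * hρ)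
    (by rw [← ΔK, ← nK]; linear_combination 27 * t3 - 9 * n * t2 + 3 * (n : K) ^ 2 * t1)
    (by
      rw [← ΔK, ← nK]
      linear_combination 27 * t4 - 9 * n * (ρ + ρ' + ρ'' + n) * t1 + 9 * (n : K) ^ 2 * t1)
    hNK
    (by exact_mod_cast E1) (by exact_mod_cast E2) s0
    m1 m2 m3 u v w
  have z1 : α + α' + α'' = 0 := by
    have := (key 1 0 0).1
    linear_combination this
  have z2 : α * α' + α' * α'' + α'' * α = -3 * (d * e) := by
    have := (key 1 0 0).2.1
    linear_combination this
  have z3 : α * α' * α'' = d * e * (2 * g - h) := by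
    have := (key 1 0 0).2.2
    linear_combination this
  have iα : IsIntegral ℤ α := c3_cubic_int α (-3 * (d * e)) (d * e * (2 * g - h)) (by
    push_cast; rw [← z2, ← z3]; linear_combination α ^ 2 * z1)
  have iα' : IsIntegral ℤ α' := by rw [← sα]; exact iα.map (σ.restrictScalars ℤ)
  have iα'' : IsIntegral ℤ α'' := by rw [← sα']; exact iα'.map (σ.restrictScalars ℤ)
  have fwd : ∀ x ∈ Submodule.span ℤ {α, α', α''}, ∃ u v : ℤ, x = u * α + v * α' := by
    intro x hx
    obtain ⟨a, b, c, rfl⟩ := Submodule.mem_span_triple.1 hx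
    refine ⟨a - c, b - c, ?_⟩
    simp only [zsmul_eq_mul]
    push_cast
    linear_combination c * z1
  have bwd : ∀ u v w : ℤ, (u * α + v * α' + w : K) ∈
      Submodule.span ℤ {α, α', α''} ⊔ Submodule.span ℤ {(1 : K)} := by
    intro u v w
    refine Submodule.add_mem_sup (Submodule.mem_span_triple.2 ⟨u, v, 0, ?_⟩)
      (Submodule.mem_span_singleton.2 ⟨w, ?_⟩)
    · simp only [zsmul_eq_mul]; push_cast; ring
    · simp only [zsmul_eq_mul]; ring
  refine ⟨iα, ?_, ?_⟩
  · apply le_antisymm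
    · apply sup_le
      · rw [Submodule.span_le]
        rintro x (rfl | rfl | rfl)
        · exact iα
        · exact iα'
        · exact iα''
      · rw [Submodule.span_le]
        rintro x rfl
        exact isIntegral_one
    · -- descent at a prime
      have prime_step : ∀ p : ℕ, p.Prime → ∀ z : K, IsIntegral ℤ z →
          (∃ u v w : ℤ, (p : K) * z = u * α + v * α' + w) →
          ∃ u v w : ℤ, z = u * α + v * α' + w := by
        rintro p hp z hz ⟨u, v, w, hzz⟩
        have pZ : Prime (p : ℤ) := Nat.prime_iff_prime_int.1 hp
        have p0 : (p : K) ≠ 0 := by exact_mod_cast hp.ne_zero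
        have iz' : IsIntegral ℤ (σ z) := hz.map (σ.restrictScalars ℤ)
        have iz'' : IsIntegral ℤ (σ (σ z)) := iz'.map (σ.restrictScalars ℤ)
        have hz' : (p : K) * σ z = u * α' + v * α'' + w := by
          have := congrArg σ hzz
          simpa only [map_add, map_mul, map_natCast, map_intCast, sα, sα'] using this
        have hz'' : (p : K) * σ (σ z) = u * α'' + v * α + w := by
          have := congrArg σ hz'
          simpa only [map_add, map_mul, map_natCast, map_intCast, sα', sα''] using this
        obtain ⟨k1, k2, k3⟩ := key u v w
        rw [← hzz, ← hz', ← hz''] at k1 k2 k3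
        have d1 : (p : ℤ) ∣ 3 * w := c3_int_dvd _ ((hz.add iz').add iz'') _ _ pZ.ne_zero (by
          push_cast; linear_combination k1)
        have d2 : (p : ℤ) ^ 2 ∣ 3 * w ^ 2 - 3 * (d * e) * (u ^ 2 - u * v + v ^ 2) :=
          c3_int_dvd _ (((hz.mul iz').add (iz'.mul iz'')).add (iz''.mul hz)) _ _
            (pow_ne_zero 2 pZ.ne_zero) (by push_cast; linear_combination k2)
        have d3 : (p : ℤ) ^ 3 ∣ w ^ 3 - 3 * (d * e) * (u ^ 2 - u * v + v ^ 2) * w +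
            (d * e) * ((u ^ 3 + v ^ 3 - 3 * u * v ^ 2) * (2 * g - h)
              - (3 * u ^ 2 * v - 3 * u * v ^ 2) * (g + h)) :=
          c3_int_dvd _ ((hz.mul iz').mul iz'') _ _
            (pow_ne_zero 3 pZ.ne_zero) (by push_cast; linear_combination k3)
        have fin : (p : ℤ) ∣ u ∧ (p : ℤ) ∣ v ∧ (p : ℤ) ∣ w := by
          by_cases h3 : p = 3
          · subst h3
            exact c3_prime_eq3 u v w g h (d * e) hgh n3d n3h d2 d3
          · refine c3_prime_ne3 p u v w g h (d * e) pZ ?_ hgh hsqD d1 d2 d3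
            intro hd3
            have : p ∣ 3 := by exact_mod_cast hd3
            exact h3 ((Nat.prime_dvd_prime_iff_eq hp Nat.prime_three).1 this)
        obtain ⟨⟨u', rfl⟩, ⟨v', rfl⟩, ⟨w', rfl⟩⟩ := fin
        refine ⟨u', v', w', mul_left_cancel₀ p0 ?_⟩
        rw [hzz]; push_cast; ring
      have all_step : ∀ N : ℕ, N ≠ 0 → ∀ z : K, IsIntegral ℤ z →
          (∃ u v w : ℤ, (N : K) * z = u * α + v * α' + w) →
          ∃ u v w : ℤ, z = u * α + v * α' + w := by
        intro N
        induction N using induction_on_primes with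
        | zero => intro h0; exact absurd rfl h0
        | one => intro _ z _ hz; simpa using hz
        | prime_mul p a hp ih =>
          rintro hpa z hz ⟨u, v, w, huvw⟩
          have ha : a ≠ 0 := right_ne_zero_of_mul hpa
          apply ih ha z hz
          apply prime_step p hp
          · have : IsIntegral ℤ ((a : ℤ) : K) := isIntegral_algebraMap
            have h2 := this.mul hz
            exact_mod_cast h2
          · refine ⟨u, v, w, ?_⟩
            rw [← huvw]; push_cast; ring
      intro x hx
      have ix : IsIntegral ℤ x := hx
      have pρ : ρ = C * ((a₀ - a₁) * α - a₁ * α') + (3 * k + 1) := by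
        apply mul_left_cancel₀ s0
        linear_combination -(C * (a₀ - a₁)) * m1 + C * a₁ * m2 - C * (3 * ρ - n) * hNK
          + 3 * C * a₁ ^ 2 * t1 + 3 * e * C ^ 2 * nK
      have pρ' : ρ' = C * (a₁ * α + a₀ * α') + (3 * k + 1) := by
        apply mul_left_cancel₀ s0
        linear_combination -(C * a₁) * m1 - C * a₀ * m2 - C * (3 * ρ' - n) * hNK
          - 3 * C * a₀ * a₁ * t1 + 3 * e * C ^ 2 * nK
      obtain ⟨N, hN, b₀, b₁, b₂, hb⟩ := c3_span n ρ hρ hgen x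
      have hρ2 : ρ ^ 2 = ρ' + (n + 1) * ρ + 2 := by rw [q1]; ring
      obtain ⟨u, v, w, hx'⟩ := all_step N hN x ix
        ⟨C * ((b₁ + b₂ * (n + 1)) * (a₀ - a₁) + b₂ * a₁),
          C * (-(b₁ + b₂ * (n + 1)) * a₁ + b₂ * a₀),
          b₀ + 2 * b₂ + (b₁ + b₂ * (n + 1) + b₂) * (3 * k + 1), by
          rw [hb, hρ2]
          push_cast
          linear_combination (b₁ + b₂ * (n + 1) : K) * pρ + (b₂ : K) * pρ'⟩
      rw [hx']
      exact bwd u v w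
  · rw [eq_bot_iff]
    rintro x ⟨hx1, hx2⟩
    obtain ⟨u, v, hx⟩ := fwd x hx1
    obtain ⟨m, rfl⟩ := Submodule.mem_span_singleton.1 hx2
    have := (key u v 0).1
    rw [zsmul_eq_mul, mul_one] at hx
    have e1 := congrArg σ hx
    rw [map_intCast, map_add, map_mul, map_mul, map_intCast, map_intCast, sα, sα'] at e1
    have e2 := congrArg σ e1
    rw [map_intCast, map_add, map_mul, map_mul, map_intCast, map_intCast, sα', sα''] at e2
    have e3 : (m : K) = 0 := by
      have : (3 : K) * m = 0 := by linear_combination hx + e1 + e2 + this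
      simpa using this
    simp [e3]
end

section
/- Suppose n ≡ 0 or 6 (mod 9). Write Δ_n = n²+3n+9 = de²c³ (d, e squarefree coprime positive, c positive), and let a₀, a₁ be integers with ec = 3(a₀² - a₀a₁ + a₁²) and a₀ + a₁ζ dividing A_n = n + 3 + 3ζ in ℤ[ζ]. Let ρ be a root of f_n and ρ' = -1/(1+ρ). Then α := (3a₀ρ + 3a₁ρ' - n(a₀+a₁))/(ec²) is an algebraic integer, and O_{L_n} = ℤ[G]·α ⊕ ℤ as ℤ-modules. -/
open Polynomial

theorem dvd_aux (n a₀ a₁ : ℤ) (hdvd : ((a₀ : AdjoinRoot (X ^ 2 + X + 1 : ℤ[X])) +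
        (a₁ : AdjoinRoot (X ^ 2 + X + 1 : ℤ[X])) * AdjoinRoot.root _) ∣
        ((n : AdjoinRoot (X ^ 2 + X + 1 : ℤ[X])) + 3 + 3 * AdjoinRoot.root _)) :
    ∃ b₀ b₁ : ℤ, a₀ * b₀ - a₁ * b₁ = n + 3 ∧ a₀ * b₁ + a₁ * b₀ - a₁ * b₁ = 3 := by
  have hz : (X ^ 2 + X + 1 : ℤ[X]).eval₂ (Int.castRingHom (QuadraticAlgebra ℤ (-1) (-1)))
      QuadraticAlgebra.omega = 0 := by
    simp only [eval₂_add, eval₂_pow, eval₂_X, eval₂_one]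
    ext <;> simp [pow_two, QuadraticAlgebra.re_one, QuadraticAlgebra.im_one]
  obtain ⟨w, hw⟩ := map_dvd (AdjoinRoot.lift _ _ hz) hdvd
  rw [map_add, map_add, map_add, map_mul, map_mul, AdjoinRoot.lift_root, map_intCast, map_intCast, map_ofNat] at hw
  refine ⟨w.re, w.im, ?_, ?_⟩
  · have := congrArg QuadraticAlgebra.re hw
    simp [QuadraticAlgebra.re_ofNat, QuadraticAlgebra.im_ofNat] at this
    linarith
  · have := congrArg QuadraticAlgebra.im hw
    simp [QuadraticAlgebra.re_ofNat, QuadraticAlgebra.im_ofNat] at this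
    linarith

/-- integer part -/
theorem arith_aux (n d e c a₀ a₁ b₀ b₁ : ℤ) (hn : n % 9 = 0 ∨ n % 9 = 6)
    (hd : 0 < d) (he : 0 < e) (hc : 0 < c)
    (hsqd : Squarefree d) (hsqe : Squarefree e) (hde : IsCoprime d e)
    (hΔ : n ^ 2 + 3 * n + 9 = d * e ^ 2 * c ^ 3)
    (hec : e * c = 3 * (a₀ ^ 2 - a₀ * a₁ + a₁ ^ 2))
    (h₀ : a₀ * b₀ - a₁ * b₁ = n + 3) (h₁ : a₀ * b₁ + a₁ * b₀ - a₁ * b₁ = 3) :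
    ∃ m E y₀ y₁ : ℤ, n = 3 * m ∧ e = 3 * E ∧ 0 < E ∧
      a₀ ^ 2 - a₀ * a₁ + a₁ ^ 2 = E * c ∧ d * E ^ 2 * c ^ 3 = m ^ 2 + m + 1 ∧
      E * c ^ 2 * (y₀ * a₀ - y₁ * a₁) =
        (a₀ ^ 2 - 2 * a₀ * a₁) * (m + 1) - (a₁ ^ 2 - 2 * a₀ * a₁) ∧
      E * c ^ 2 * (y₀ * a₁ + y₁ * a₀ - y₁ * a₁) = (a₀ ^ 2 - 2 * a₀ * a₁)
        + (a₁ ^ 2 - 2 * a₀ * a₁) * (m + 1) - (a₁ ^ 2 - 2 * a₀ * a₁) ∧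
      y₀ ^ 2 - y₀ * y₁ + y₁ ^ 2 = d * E ∧
      IsCoprime (9 * (d * E)) y₁ ∧ Squarefree (d * E) ∧ ¬ (3 : ℤ) ∣ d * E ∧
      (∀ p : ℤ, Prime p → p ∣ d * E → ¬ p ∣ 2 * y₀ - y₁) ∧
      ((9 : ℤ) ∣ d * E * (2 * y₀ - y₁) - 1 ∨ (9 : ℤ) ∣ d * E * (2 * y₀ - y₁) + 1) := by
  obtain ⟨m, rfl⟩ : (3 : ℤ) ∣ n := by omega
  have hm : m % 3 = 0 ∨ m % 3 = 2 := by omega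
  have p3 : Prime (3 : ℤ) := Int.prime_three
  -- 3 ∣ e
  have hm3 : ¬ (3 : ℤ) ∣ m ^ 2 + m + 1 := by
    obtain ⟨k, hk⟩ : ∃ k, m = 3 * k ∨ m = 3 * k + 2 := ⟨m / 3, by omega⟩
    rintro ⟨l, hl⟩
    rcases hk with rfl | rfl
    · have : 3 * (3 * k ^ 2 + k - l) = -1 := by linarith
      omega
    · have : 3 * (3 * k ^ 2 + 5 * k + 2 - l) = -1 := by linarith
      omega
  have hΔ9 : d * e ^ 2 * c ^ 3 = 9 * (m ^ 2 + m + 1) := by rw [← hΔ]; ring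
  have h3c : ¬ (3 : ℤ) ∣ c := by
    rintro ⟨k, rfl⟩
    exact hm3 ⟨d * e ^ 2 * k ^ 3, by linarith⟩
  have h3e : (3 : ℤ) ∣ e := by
    rcases p3.dvd_or_dvd (⟨_, hec⟩ : (3 : ℤ) ∣ e * c) with h | h
    · exact h
    · exact absurd h h3c
  obtain ⟨E, rfl⟩ := h3e
  have hE : 0 < E := by linarith
  have hB : d * E ^ 2 * c ^ 3 = m ^ 2 + m + 1 := by linarith
  have hN : a₀ ^ 2 - a₀ * a₁ + a₁ ^ 2 = E * c := by linarith
  have hNb : (E * c) * (b₀ ^ 2 - b₀ * b₁ + b₁ ^ 2) = (E * c) * (9 * (d * E * c ^ 2)) := by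
    rw [← hN]
    have : (a₀ ^ 2 - a₀ * a₁ + a₁ ^ 2) * (b₀ ^ 2 - b₀ * b₁ + b₁ ^ 2) =
      (a₀ * b₀ - a₁ * b₁) ^ 2 - (a₀ * b₀ - a₁ * b₁) * (a₀ * b₁ + a₁ * b₀ - a₁ * b₁)
        + (a₀ * b₁ + a₁ * b₀ - a₁ * b₁) ^ 2 := by ring
    rw [this, h₀, h₁, hN]
    linear_combination -9 * hB
  have hEc : E * c ≠ 0 := by positivity
  have hNb' := mul_left_cancel₀ hEc hNb
  obtain ⟨g₀, g₁, rfl, rfl⟩ : ∃ g₀ g₁, b₀ = 3 * g₀ ∧ b₁ = 3 * g₁ := by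
    have h1 : (3 : ℤ) ∣ b₀ + b₁ := by
      have : (3 : ℤ) ∣ (b₀ + b₁) ^ 2 := ⟨3 * (d * E * c ^ 2) + b₀ * b₁, by linarith⟩
      exact p3.dvd_of_dvd_pow this
    obtain ⟨k, hk⟩ := h1
    obtain rfl : b₀ = 3 * k - b₁ := by linarith
    have h2 : (3 : ℤ) ∣ b₁ := by
      have : (3 : ℤ) ∣ b₁ ^ 2 := ⟨d * E * c ^ 2 - k ^ 2 + k * b₁, by linarith⟩
      exact p3.dvd_of_dvd_pow this
    obtain ⟨l, rfl⟩ := h2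
    exact ⟨k - l, l, by ring, rfl⟩
  have hΓ : g₀ ^ 2 - g₀ * g₁ + g₁ ^ 2 = d * E * c ^ 2 := by linarith
  have k₀ : a₀ * g₀ - a₁ * g₁ = m + 1 := by linarith
  have k₁ : a₀ * g₁ + a₁ * g₀ - a₁ * g₁ = 1 := by linarith
  clear hn hΔ hec h₀ h₁ hNb hNb' hΔ9
  have ka : a₀ - a₁ * (m + 1) = E * c * g₁ := by
    rw [← k₀, ← hN]; linear_combination (-a₀) * k₁
  have kg : g₀ - g₁ * (m + 1) = d * E * c ^ 2 * a₁ := by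
    rw [← k₀, ← hΓ]; linear_combination (-g₀) * k₁
  obtain ⟨y₀, hy₀⟩ : ∃ y, y = 3*a₁^2*g₁*d*E*c*m + a₁^3*d*(m^2-1) + 2*a₁*g₁^2*d*E^2*c^2
    + E*g₁^2*g₀ := ⟨_, rfl⟩
  obtain ⟨y₁, hy₁⟩ : ∃ y, y = -3*a₁^2*g₁*d*E*c - a₁^3*d*(2*m+1) + E*g₁^3 := ⟨_, rfl⟩
  have ea : a₀ = a₁ * (m + 1) + E * c * g₁ := by linarith
  have eg : g₀ = g₁ * (m + 1) + d * E * c ^ 2 * a₁ := by linarith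
  have i₀ : E * c ^ 2 * y₀ = (a₀ ^ 2 - 2 * a₀ * a₁) * g₀ - (a₁ ^ 2 - 2 * a₀ * a₁) * g₁ := by
    rw [hy₀, ea, eg]
    linear_combination (a₁ ^ 2 * g₁ * m + 2 * a₁ * g₁ ^ 2 * E * c) * hB
  have i₁ : E * c ^ 2 * y₁ = (a₀ ^ 2 - 2 * a₀ * a₁) * g₁ + (a₁ ^ 2 - 2 * a₀ * a₁) * g₀
        - (a₁ ^ 2 - 2 * a₀ * a₁) * g₁ := by
    rw [hy₁, ea, eg]
    linear_combination (-a₁ ^ 2 * g₁) * hB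
  have hNy : y₀ ^ 2 - y₀ * y₁ + y₁ ^ 2 = d * E := by
    have : (E * c ^ 2) ^ 2 * (y₀ ^ 2 - y₀ * y₁ + y₁ ^ 2) = (E * c ^ 2) ^ 2 * (d * E) := by
      calc _ = (E * c ^ 2 * y₀) ^ 2 - (E * c ^ 2 * y₀) * (E * c ^ 2 * y₁)
              + (E * c ^ 2 * y₁) ^ 2 := by ring
        _ = (a₀ ^ 2 - a₀ * a₁ + a₁ ^ 2) ^ 2 * (g₀ ^ 2 - g₀ * g₁ + g₁ ^ 2) := by
            rw [i₀, i₁]; ring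
        _ = _ := by rw [hN, hΓ]; ring
    exact mul_left_cancel₀ (by positivity) this
  have h3E : ¬ (3 : ℤ) ∣ d * E := by
    rintro ⟨k, hk⟩
    exact hm3 ⟨k * E * c ^ 3, by rw [← hB]; linear_combination E * c ^ 3 * hk⟩
  have hdE : IsCoprime d E := hde.of_isCoprime_of_dvd_right ⟨3, by ring⟩
  have hsqE : Squarefree E := hsqe.squarefree_of_dvd ⟨3, by ring⟩
  have hnot1 : ∀ p : ℤ, Prime p → ¬ p ∣ 1 := fun p hp h => hp.not_isUnit (isUnit_of_dvd_one h)
  have hpy : ∀ p : ℤ, Prime p → p ∣ d * E → ¬ p ∣ y₁ := by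
    intro p hp hpd hpy
    have hp3 : ¬ p ∣ 3 := by
      intro h
      have := (hp.associated_of_dvd p3 h)
      exact h3E (this.symm.dvd.trans hpd)
    rcases hp.dvd_or_dvd hpd with h | h
    · have hpE : ¬ p ∣ E := fun h' => hp.not_isUnit (hdE.isUnit_of_dvd' h h')
      have : p ∣ E * g₁ ^ 3 := by
        have e1 : E * g₁ ^ 3 = y₁ + d * (3*a₁^2*g₁*E*c + a₁^3*(2*m+1)) := by rw [hy₁]; ring
        rw [e1]; exact dvd_add hpy (h.mul_right _)
      have hg1 : p ∣ g₁ := hp.dvd_of_dvd_pow ((hp.dvd_or_dvd this).resolve_left hpE)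
      have hg0 : p ∣ g₀ := by
        rw [eg]; exact dvd_add (hg1.mul_right _) (((h.mul_right _).mul_right _).mul_right _)
      apply hnot1 p hp
      rw [← k₁]
      exact dvd_sub (dvd_add (hg1.mul_left _) (hg0.mul_left _)) (hg1.mul_left _)
    · have hpE : ¬ p ∣ d := fun h' => hp.not_isUnit (hdE.isUnit_of_dvd' h' h)
      have : p ∣ d * (a₁ ^ 3 * (2 * m + 1)) := by
        have e1 : d * (a₁ ^ 3 * (2 * m + 1)) = E * (g₁^3 - 3*a₁^2*g₁*d*c) - y₁ := by
          rw [hy₁]; ring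
        rw [e1]; exact dvd_sub (h.mul_right _) hpy
      rcases hp.dvd_or_dvd ((hp.dvd_or_dvd this).resolve_left hpE) with h' | h'
      · have ha1 := hp.dvd_of_dvd_pow h'
        have ha0 : p ∣ a₀ := by
          rw [ea]; exact dvd_add (ha1.mul_right _) ((h.mul_right _).mul_right _)
        apply hnot1 p hp
        rw [← k₁]
        exact dvd_sub (dvd_add (ha0.mul_right _) (ha1.mul_right _)) (ha1.mul_right _)
      · apply hp3
        have e1 : (3 : ℤ) = E * (4 * (d * E * c ^ 3)) - (2 * m + 1) * (2 * m + 1) := by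
          linear_combination (-4) * hB
        rw [e1]
        exact dvd_sub (h.mul_right _) (h'.mul_right _)
  have hpt : ∀ p : ℤ, Prime p → p ∣ d * E → ¬ p ∣ 2 * y₀ - y₁ := by
    intro p hp hpd hpt
    have hp3 : ¬ p ∣ 3 := by
      intro h
      have := (hp.associated_of_dvd p3 h)
      exact h3E (this.symm.dvd.trans hpd)
    have : p ∣ 3 * y₁ ^ 2 := by
      have e1 : 3 * y₁ ^ 2 = d * E * 4 - (2 * y₀ - y₁) * (2 * y₀ - y₁) := by
        linear_combination 4 * hNy
      rw [e1]; exact dvd_sub (hpd.mul_right _) (hpt.mul_right _)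
    exact hpy p hp hpd (hp.dvd_of_dvd_pow ((hp.dvd_or_dvd this).resolve_left hp3))
  -- the cube of conj a times B
  obtain ⟨P, hP⟩ : ∃ P, P = (a₀ - a₁) ^ 3 - a₁ ^ 3 - 3 * (a₀ - a₁) * a₁ ^ 2 := ⟨_, rfl⟩
  obtain ⟨Q, hQ⟩ : ∃ Q, Q = - (a₀ - a₁) * a₁ * a₀ := ⟨_, rfl⟩
  have j₀ : E ^ 2 * c ^ 3 * y₀ = P * (m + 1) - 3 * Q := by
    rw [hP, hQ]
    linear_combination (E * c) * i₀
      - ((a₀ ^ 2 - 2 * a₀ * a₁) * g₀ - (a₁ ^ 2 - 2 * a₀ * a₁) * g₁) * hN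
      + ((a₀ - a₁) ^ 3 - a₁ ^ 3 - 3 * (a₀ - a₁) * a₁ ^ 2) * k₀
      - 3 * (- (a₀ - a₁) * a₁ * a₀) * k₁
  have j₁ : E ^ 2 * c ^ 3 * y₁ = P + 3 * Q * (m + 1) - 3 * Q := by
    rw [hP, hQ]
    linear_combination (E * c) * i₁
      - ((a₀ ^ 2 - 2 * a₀ * a₁) * g₁ + (a₁ ^ 2 - 2 * a₀ * a₁) * g₀
        - (a₁ ^ 2 - 2 * a₀ * a₁) * g₁) * hN
      + ((a₀ - a₁) ^ 3 - a₁ ^ 3 - 3 * (a₀ - a₁) * a₁ ^ 2) * k₁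
      + 3 * (- (a₀ - a₁) * a₁ * a₀) * (k₀ - k₁)
  have h3N : ¬ (3 : ℤ) ∣ a₀ ^ 2 - a₀ * a₁ + a₁ ^ 2 := by
    rw [hN]
    intro h
    rcases p3.dvd_or_dvd h with h | h
    · exact h3E (h.mul_left _)
    · exact h3c h
  have h3y : ¬ (3 : ℤ) ∣ y₁ := by
    intro h
    have h1 : (3 : ℤ) ∣ P := by
      have : P = E ^ 2 * c ^ 3 * y₁ - 3 * (Q * (m + 1) - Q) := by linarith
      rw [this]; exact dvd_sub (h.mul_left _) (dvd_mul_right _ _)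
    have h2 : (3 : ℤ) ∣ (a₀ + a₁) ^ 3 := by
      have : (a₀ + a₁) ^ 3 = P + 3 * (2 * a₀ ^ 2 * a₁ + a₀ * a₁ ^ 2) := by
        rw [hP]; ring
      rw [this]; exact dvd_add h1 (dvd_mul_right _ _)
    have h3 := p3.dvd_of_dvd_pow h2
    apply h3N
    have : a₀ ^ 2 - a₀ * a₁ + a₁ ^ 2 = (a₀ + a₁) * (a₀ + a₁) - 3 * (a₀ * a₁) := by ring
    rw [this]
    exact dvd_sub (h3.mul_right _) (dvd_mul_right _ _)
  refine ⟨m, E, y₀, y₁, rfl, rfl, hE, hN, hB,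
    by linear_combination a₀ * i₀ - a₁ * i₁ + (a₀ ^ 2 - 2 * a₀ * a₁) * k₀
      - (a₁ ^ 2 - 2 * a₀ * a₁) * k₁,
    by linear_combination a₁ * i₀ + (a₀ - a₁) * i₁ + (a₀ ^ 2 - 2 * a₀ * a₁) * k₁
      + (a₁ ^ 2 - 2 * a₀ * a₁) * (k₀ - k₁), hNy, ?_, ?_, h3E, hpt, ?_⟩
  · have c3 : IsCoprime (3 : ℤ) y₁ := (p3.coprime_iff_not_dvd).2 h3y
    refine IsCoprime.mul_left ?_ ?_
    · exact (by norm_num : (9 : ℤ) = 3 * 3) ▸ c3.mul_left c3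
    · apply isCoprime_of_prime_dvd
      · rintro ⟨h, -⟩
        exact (by positivity : d * E ≠ 0) h
      · exact hpy
  · exact (squarefree_mul_iff).2 ⟨hdE.isRelPrime, hsqd, hsqE⟩
  · have key : d * E * (2 * y₀ - y₁) * (a₀ ^ 2 - a₀ * a₁ + a₁ ^ 2) ^ 3 * c ^ 3 =
        (m ^ 2 + m + 1) * (2 * (P * (m + 1) - 3 * Q) - (P + 3 * Q * (m + 1) - 3 * Q)) := by
      rw [hN, ← hB, ← j₀, ← j₁]; ring
    have cube : ∀ z : ℤ, ¬ (3 : ℤ) ∣ z → ((z : ZMod 9) ^ 3 = 1 ∨ (z : ZMod 9) ^ 3 = -1) := by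
      intro z hz
      have h3 : ((3 * z : ℤ) : ZMod 9) ≠ 0 := by
        rw [Ne, ZMod.intCast_zmod_eq_zero_iff_dvd]
        intro h
        push_cast at h
        omega
      push_cast at h3
      revert h3
      generalize (z : ZMod 9) = w
      revert w
      decide
    have hm9 : (3 : ZMod 9) * (m * (m + 1)) = 0 := by
      have : ((3 * (m * (m + 1)) : ℤ) : ZMod 9) = 0 := by
        rw [ZMod.intCast_zmod_eq_zero_iff_dvd]
        have : (3 : ℤ) ∣ m * (m + 1) := by
          rcases hm with h | h
          · exact (Int.dvd_of_emod_eq_zero h).mul_right _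
          · exact Dvd.dvd.mul_left (by omega) _
        push_cast
        omega
      exact_mod_cast this
    have hs := cube (a₀ + a₁) (by
      intro h3
      apply h3N
      have : a₀ ^ 2 - a₀ * a₁ + a₁ ^ 2 = (a₀ + a₁) * (a₀ + a₁) - 3 * (a₀ * a₁) := by ring
      rw [this]
      exact dvd_sub (h3.mul_right _) (dvd_mul_right _ _))
    have cN := cube _ h3N
    have cc := cube _ h3c
    have key9 := congrArg (Int.cast : ℤ → ZMod 9) key
    have fin9 : ∀ m a b : ZMod 9, 3 * (m * (m + 1)) = 0 → ((a + b) ^ 3 = 1 ∨ (a + b) ^ 3 = -1) →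
        ((m ^ 2 + m + 1) * (2 * ((a ^ 3 - 3 * a ^ 2 * b + b ^ 3) * (m + 1) - 3 * (- (a - b) * b * a))
          - ((a ^ 3 - 3 * a ^ 2 * b + b ^ 3) + 3 * (- (a - b) * b * a) * (m + 1)
            - 3 * (- (a - b) * b * a))) = 1 ∨
        (m ^ 2 + m + 1) * (2 * ((a ^ 3 - 3 * a ^ 2 * b + b ^ 3) * (m + 1) - 3 * (- (a - b) * b * a))
          - ((a ^ 3 - 3 * a ^ 2 * b + b ^ 3) + 3 * (- (a - b) * b * a) * (m + 1)
            - 3 * (- (a - b) * b * a))) = -1) := by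
      decide +kernel
    have hP' : P = a₀ ^ 3 - 3 * a₀ ^ 2 * a₁ + a₁ ^ 3 := by rw [hP]; ring
    push_cast at cN cc hs
    rw [hP', hQ] at key9
    push_cast at key9
    have f := fin9 m a₀ a₁ hm9 hs
    rw [← key9] at f
    have goal9 : ((d * E * (2 * y₀ - y₁) : ℤ) : ZMod 9) = 1 ∨
        ((d * E * (2 * y₀ - y₁) : ℤ) : ZMod 9) = -1 := by
      push_cast
      generalize (d * E * (2 * y₀ - y₁) : ZMod 9) = t at *
      rcases cN with h | h <;> rcases cc with h' | h' <;> rw [h, h'] at f <;>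
        rcases f with f | f <;> ring_nf at f ⊢ <;>
        first
        | exact Or.inl f
        | exact Or.inr f
        | exact Or.inr (neg_eq_iff_eq_neg.1 f)
        | exact Or.inl (neg_injective f)
    rcases goal9 with h | h
    · left
      have := (ZMod.intCast_zmod_eq_zero_iff_dvd (d * E * (2 * y₀ - y₁) - 1) 9).1 (by
        rw [Int.cast_sub, h]; simp)
      exact_mod_cast this
    · right
      have := (ZMod.intCast_zmod_eq_zero_iff_dvd (d * E * (2 * y₀ - y₁) + 1) 9).1 (by
        rw [Int.cast_add, h]; simp)
      exact_mod_cast this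

theorem coeff0_aux (a b c : ℤ) :
    (X ^ 3 + C a * X ^ 2 + C b * X + C c : ℤ[X]).coeff 0 = c := by
  simp only [coeff_add, coeff_C_mul, coeff_X_pow, coeff_X, coeff_C]
  norm_num

theorem coeff1_aux (a b c : ℤ) :
    (X ^ 3 + C a * X ^ 2 + C b * X + C c : ℤ[X]).coeff 1 = b := by
  simp only [coeff_add, coeff_C_mul, coeff_X_pow, coeff_X, coeff_C]
  norm_num

theorem coeff2_aux (a b c : ℤ) :
    (X ^ 3 + C a * X ^ 2 + C b * X + C c : ℤ[X]).coeff 2 = a := by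
  simp only [coeff_add, coeff_C_mul, coeff_X_pow, coeff_X, coeff_C]
  norm_num

theorem coeff3_aux (a b c : ℤ) :
    (X ^ 3 + C a * X ^ 2 + C b * X + C c : ℤ[X]).coeff 3 = 1 := by
  simp only [coeff_add, coeff_C_mul, coeff_X_pow, coeff_X, coeff_C]
  norm_num

theorem eis_aux (p a b c : ℤ) (hp : Prime p) (ha : p ∣ a) (hb : p ∣ b) (hc : p ∣ c)
    (hc2 : ¬ p ^ 2 ∣ c) :
    (X ^ 3 + C a * X ^ 2 + C b * X + C c : ℤ[X]).IsEisensteinAt (Ideal.span {p}) := by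
  have hdeg : (X ^ 3 + C a * X ^ 2 + C b * X + C c : ℤ[X]).natDegree = 3 := by compute_degree!
  refine ⟨?_, ?_, ?_⟩
  · rw [leadingCoeff, hdeg, Ideal.mem_span_singleton, coeff3_aux]
    intro h
    exact hp.not_isUnit (isUnit_of_dvd_one h)
  · intro k hk
    rw [hdeg] at hk
    rw [Ideal.mem_span_singleton]
    interval_cases k
    · rwa [coeff0_aux]
    · rwa [coeff1_aux]
    · rwa [coeff2_aux]
  · rw [Ideal.span_singleton_pow, Ideal.mem_span_singleton]
    rwa [coeff0_aux]

theorem minpoly_aux {K : Type*} [Field K] [NumberField K] (x : K) (q : ℤ[X]) (hq : q.Monic)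
    (hirr : Irreducible q) (hx : aeval x q = 0) :
    minpoly ℤ x = q ∧ minpoly ℚ x = q.map (algebraMap ℤ ℚ) := by
  have hint : IsIntegral ℤ x := ⟨q, hq, hx⟩
  have h1 : minpoly ℚ x = q.map (algebraMap ℤ ℚ) := by
    refine (minpoly.eq_of_irreducible_of_monic ?_ ?_ (hq.map _)).symm
    · exact (hq.irreducible_iff_irreducible_map_fraction_map).1 hirr
    · rw [aeval_map_algebraMap, hx]
  refine ⟨?_, h1⟩
  rw [minpoly.isIntegrallyClosed_eq_field_fractions' ℚ hint] at h1
  exact map_injective _ (algebraMap ℤ ℚ).injective_int h1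

theorem cubic_eis {K : Type*} [Field K] [NumberField K] (hK : Module.finrank ℚ K = 3)
    (x : K) (p a b c : ℤ) (hp : Prime p) (ha : p ∣ a) (hb : p ∣ b) (hc : p ∣ c)
    (hc2 : ¬ p ^ 2 ∣ c) (hx : x ^ 3 + a * x ^ 2 + b * x + c = 0) :
    (∃ B : PowerBasis ℚ K, B.gen = x ∧ B.dim = 3) ∧ Algebra.trace ℚ K x = -a ∧
    ∀ z : K, IsIntegral ℤ z → p • z ∈ Algebra.adjoin ℤ {x} → z ∈ Algebra.adjoin ℤ {x} := by
  have hdeg : (X ^ 3 + C a * X ^ 2 + C b * X + C c : ℤ[X]).natDegree = 3 := by compute_degree!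
  have hmon : (X ^ 3 + C a * X ^ 2 + C b * X + C c : ℤ[X]).Monic := by monicity!
  have heis := eis_aux p a b c hp ha hb hc hc2
  have hirr : Irreducible (X ^ 3 + C a * X ^ 2 + C b * X + C c : ℤ[X]) :=
    heis.irreducible ((Ideal.span_singleton_prime hp.ne_zero).2 hp) hmon.isPrimitive (by omega)
  have hae : aeval x (X ^ 3 + C a * X ^ 2 + C b * X + C c : ℤ[X]) = 0 := by
    simpa using hx
  obtain ⟨hm1, hm2⟩ := minpoly_aux x _ hmon hirr hae
  have hint : IsIntegral ℤ x := ⟨_, hmon, hae⟩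
  have hintQ : IsIntegral ℚ x := hint.tower_top
  have hdegQ : (minpoly ℚ x).natDegree = 3 := by
    rw [hm2, natDegree_map_eq_of_injective (algebraMap ℤ ℚ).injective_int, hdeg]
  have htop : Algebra.adjoin ℚ {x} = ⊤ := by
    have := (Field.primitive_element_iff_minpoly_natDegree_eq ℚ x).2 (by rw [hK, hdegQ])
    rw [← IntermediateField.adjoin_simple_toSubalgebra_of_isAlgebraic hintQ.isAlgebraic, this]
    rfl
  let B := PowerBasis.ofAdjoinEqTop hintQ htop
  have hB : B.gen = x := PowerBasis.ofAdjoinEqTop_gen hintQ htop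
  refine ⟨⟨B, hB, ?_⟩, ?_, ?_⟩
  · rw [← B.finrank, hK]
  · rw [← hB, B.trace_gen_eq_nextCoeff_minpoly, hB, hm2]
    rw [nextCoeff_of_natDegree_pos (by rw [← hm2, hdegQ]; norm_num), ← hm2, hdegQ, hm2, coeff_map, coeff2_aux]
    simp
  · intro z hz hpz
    rw [← hB] at hpz ⊢
    refine mem_adjoin_of_smul_prime_smul_of_minpoly_isEisensteinAt hp (hB ▸ hint) hz hpz ?_
    rw [hB, hm1]
    exact heis

theorem strip_aux {K : Type*} [Field K] [NumberField K] (S : Subalgebra ℤ K) (N : ℤ) (hN : N ≠ 0)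
    (h : ∀ p : ℤ, Prime p → p ∣ N → ∀ z : K, IsIntegral ℤ z → p • z ∈ S → z ∈ S) :
    ∀ z : K, IsIntegral ℤ z → N • z ∈ S → z ∈ S := by
  induction N using UniqueFactorizationMonoid.induction_on_prime with
  | h₁ => exact absurd rfl hN
  | h₂ x hx =>
    intro z hz hxz
    obtain ⟨u, hu⟩ := hx.exists_left_inv
    have := S.smul_mem hxz u
    rwa [smul_smul, hu, one_smul] at this
  | h₃ a p ha hp ih =>
    intro z hz hpz
    refine ih ha (fun q hq hqa => h q hq (hqa.mul_left _)) z hz ?_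
    refine h p hp (dvd_mul_right _ _) _ (hz.smul a) ?_
    rwa [smul_smul]

theorem core_aux {K : Type*} [Field K] [NumberField K] (hK : Module.finrank ℚ K = 3)
    (α α' α'' : K) (D y₀ y₁ : ℤ) (hD : D ≠ 0)
    (hsum : α + α' + α'' = 0)
    (s : α ^ 2 = 2 * D + y₀ * α + y₁ * α')
    (s' : α' ^ 2 = 2 * D + y₀ * α' + y₁ * α'')
    (s'' : α'' ^ 2 = 2 * D + y₀ * α'' + y₁ * α)
    (hN : y₀ ^ 2 - y₀ * y₁ + y₁ ^ 2 = D) (hcop : IsCoprime (9 * D) y₁) (hsq : Squarefree D)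
    (h3D : ¬ (3 : ℤ) ∣ D) (hpt : ∀ p : ℤ, Prime p → p ∣ D → ¬ p ∣ 2 * y₀ - y₁)
    (h9 : (9 : ℤ) ∣ D * (2 * y₀ - y₁) - 1 ∨ (9 : ℤ) ∣ D * (2 * y₀ - y₁) + 1) :
    IsIntegral ℤ α ∧
    Submodule.span ℤ {α, α', α''} ⊔ Submodule.span ℤ {(1 : K)} =
      Subalgebra.toSubmodule (integralClosure ℤ K) ∧
    Submodule.span ℤ {α, α', α''} ⊓ Submodule.span ℤ {(1 : K)} = ⊥ := by
  have hNK : (y₀ : K) ^ 2 - y₀ * y₁ + y₁ ^ 2 = D := by exact_mod_cast congrArg (Int.cast : ℤ → K) hN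
  have cube : ∀ x x' x'' : K, x + x' + x'' = 0 → x ^ 2 = 2 * D + y₀ * x + y₁ * x' →
      x' ^ 2 = 2 * D + y₀ * x' + y₁ * x'' → x'' ^ 2 = 2 * D + y₀ * x'' + y₁ * x →
      x * x' = - D + y₀ * x'' + y₁ * x ∧
      x ^ 3 + (0 : ℤ) * x ^ 2 + (-3 * D : ℤ) * x + (- (D * (2 * y₀ - y₁)) : ℤ) = 0 := by
    intro x x' x'' h0 h h' h''
    obtain rfl : x'' = - x - x' := by linear_combination h0
    have hm : x * x' = - D + y₀ * (- x - x') + y₁ * x := by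
      linear_combination (1 / 2 : K) * (h'' - h - h')
    refine ⟨hm, ?_⟩
    push_cast
    linear_combination (x + y₀) * h + y₁ * hm + x * hNK
  obtain ⟨ε, hε2, hε9⟩ : ∃ ε : ℤ, ε ^ 2 = 1 ∧ (9 : ℤ) ∣ D * (2 * y₀ - y₁) - ε := by
    rcases h9 with h | h
    · exact ⟨1, by norm_num, h⟩
    · exact ⟨-1, by norm_num, by simpa using h⟩
  have hεK : (ε : K) ^ 2 = 1 := by exact_mod_cast congrArg (Int.cast : ℤ → K) hε2
  have eis3 : ∀ x : K, x ^ 3 + (0 : ℤ) * x ^ 2 + (-3 * D : ℤ) * x + (- (D * (2 * y₀ - y₁)) : ℤ) = 0 →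
      IsIntegral ℤ x ∧ (∃ B : PowerBasis ℚ K, B.gen = x - ε ∧ B.dim = 3) ∧ Algebra.trace ℚ K x = 0 ∧
      ∀ z : K, IsIntegral ℤ z → (3 : ℤ) • z ∈ Algebra.adjoin ℤ {x} → z ∈ Algebra.adjoin ℤ {x} := by
    intro x hx
    have hint : IsIntegral ℤ x := by
      refine ⟨X ^ 3 + C 0 * X ^ 2 + C (-3 * D) * X + C (- (D * (2 * y₀ - y₁))), by monicity!, ?_⟩
      rw [← hx]
      simp only [eval₂_add, eval₂_mul, eval₂_pow, eval₂_X, eval₂_C]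
      simp only [eq_intCast]
    obtain ⟨hB, htr, hst⟩ := cubic_eis hK (x - ε) 3 (3 * ε) (3 - 3 * D)
      (ε - 3 * D * ε - D * (2 * y₀ - y₁)) Int.prime_three (dvd_mul_right _ _)
      ⟨1 - D, by ring⟩ (by
        have : (3 : ℤ) ∣ D * (2 * y₀ - y₁) - ε := dvd_trans (by norm_num) hε9
        have e : ε - 3 * D * ε - D * (2 * y₀ - y₁) = 3 * (- D * ε) - (D * (2 * y₀ - y₁) - ε) := by
          ring
        rw [e]; exact dvd_sub (dvd_mul_right _ _) this) (by
        intro h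
        have h2 := dvd_add h (by simpa using hε9 : (3 : ℤ) ^ 2 ∣ _)
        have e : ε - 3 * D * ε - D * (2 * y₀ - y₁) + (D * (2 * y₀ - y₁) - ε) = 3 * (- D * ε) := by
          ring
        rw [e, pow_two] at h2
        have h3 := Int.dvd_of_mul_dvd_mul_left (by norm_num) h2
        apply h3D
        have h4 := h3.mul_right (-ε)
        have e2 : -D * ε * -ε = D := by linear_combination D * hε2
        rwa [e2] at h4) (by
        push_cast at hx ⊢
        linear_combination hx + (2 * ε - 3 * x) * hεK)
    have hadj : Algebra.adjoin ℤ {x - (ε : K)} = Algebra.adjoin ℤ {x} := by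
      apply le_antisymm
      · refine Algebra.adjoin_le (Set.singleton_subset_iff.2 ?_)
        exact sub_mem (Algebra.self_mem_adjoin_singleton ℤ x) (intCast_mem _ _)
      · refine Algebra.adjoin_le (Set.singleton_subset_iff.2 ?_)
        have := add_mem (Algebra.self_mem_adjoin_singleton ℤ (x - (ε : K)))
          (intCast_mem (Algebra.adjoin ℤ {x - (ε : K)}) ε)
        rwa [sub_add_cancel] at this
    rw [hadj] at hst
    refine ⟨hint, hB, ?_, hst⟩
    have : x = (x - ε) + algebraMap ℚ K ε := by simp
    rw [this, map_add, htr, Algebra.trace_algebraMap, hK]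
    simp
  obtain ⟨hm, hc⟩ := cube α α' α'' hsum s s' s''
  obtain ⟨hm', hc'⟩ := cube α' α'' α (by linear_combination hsum) s' s'' s
  obtain ⟨hm'', hc''⟩ := cube α'' α α' (by linear_combination hsum) s'' s s'
  obtain ⟨hi, ⟨B, hBg, hBd⟩, ht, hst3⟩ := eis3 α hc
  obtain ⟨hi', -, ht', -⟩ := eis3 α' hc'
  obtain ⟨hi'', -, ht'', -⟩ := eis3 α'' hc''
  refine ⟨hi, ?_, ?_⟩
  · set M := Submodule.span ℤ {α, α', α''} ⊔ Submodule.span ℤ {(1 : K)} with hM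
    have mα : α ∈ M := Submodule.mem_sup_left (Submodule.subset_span (by simp))
    have mα' : α' ∈ M := Submodule.mem_sup_left (Submodule.subset_span (by simp))
    have mα'' : α'' ∈ M := Submodule.mem_sup_left (Submodule.subset_span (by simp))
    have m1 : (1 : K) ∈ M := Submodule.mem_sup_right (Submodule.subset_span (by simp))
    apply le_antisymm
    · refine sup_le (Submodule.span_le.2 ?_) (Submodule.span_le.2 ?_)
      · rintro z (rfl | rfl | rfl)
        exacts [hi, hi', hi'']
      · rintro z rfl
        exact isIntegral_one
    · intro x hx
      replace hx : IsIntegral ℤ x := hx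
      -- coordinates
      obtain ⟨r, u, v, hxr⟩ : ∃ r u v : ℚ, x = r + u * α + v * α' := by
        obtain ⟨f, hf, hxf⟩ := B.exists_eq_aeval x
        rw [hBd] at hf
        rw [hBg, eq_quadratic_of_degree_le_two (natDegree_le_iff_degree_le.1
          (by omega : f.natDegree ≤ 2))] at hxf
        simp only [map_add, map_mul, map_pow, aeval_C, aeval_X, eq_ratCast] at hxf
        refine ⟨f.coeff 2 * (2 * D + ε ^ 2) - f.coeff 1 * ε + f.coeff 0,
          f.coeff 2 * (y₀ - 2 * ε) + f.coeff 1, f.coeff 2 * y₁, ?_⟩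
        rw [hxf]
        push_cast
        linear_combination (f.coeff 2 : K) * s
      have tr : ∀ r u v : ℚ, Algebra.trace ℚ K (r + u * α + v * α') = 3 * r := by
        intro r u v
        have : (r : K) + u * α + v * α' = algebraMap ℚ K r + u • α + v • α' := by
          simp [Algebra.smul_def]
        rw [this, map_add, map_add, map_smul, map_smul, ht, ht', Algebra.trace_algebraMap, hK]
        simp
      have trint : ∀ z : K, IsIntegral ℤ z → ∀ q : ℚ, Algebra.trace ℚ K z = q → ∃ k : ℤ, q = k := by
        intro z hz q hq
        have := Algebra.isIntegral_trace (L := ℚ) hz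
        rw [hq] at this
        obtain ⟨k, hk⟩ := IsIntegrallyClosed.isIntegral_iff.1 this
        exact ⟨k, by rw [← hk]; simp⟩
      have e'' : α'' = - α - α' := by linear_combination hsum
      obtain ⟨k0, hk0⟩ := trint x hx (3 * r) (by rw [hxr, tr])
      obtain ⟨k1, hk1⟩ := trint (x * α) (hx.mul hi) (3 * (2 * D * u - D * v)) (by
        rw [← tr _ (r + u * y₀ - v * y₀ + v * y₁) (u * y₁ - v * y₀), hxr]
        congr 1
        push_cast
        rw [e''] at hm
        linear_combination u * s + v * hm)
      obtain ⟨k2, hk2⟩ := trint (x * α') (hx.mul hi') (3 * (2 * D * v - D * u)) (by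
        rw [← tr _ (u * (y₁ - y₀) - v * y₁) (r - u * y₀ + v * (y₀ - y₁)), hxr]
        congr 1
        push_cast
        rw [e''] at hm s'
        linear_combination u * hm + v * s')
      have hDx : (9 * D) • x = ((3 * D * k0 : ℤ) : K) + ((2 * k1 + k2 : ℤ) : K) * α
          + ((k1 + 2 * k2 : ℤ) : K) * α' := by
        have q0 : (9 * D) * r = ((3 * D * k0 : ℤ) : ℚ) := by
          push_cast; linear_combination (3 * D : ℚ) * hk0
        have q1 : (9 * D) * u = ((2 * k1 + k2 : ℤ) : ℚ) := by
          push_cast; linear_combination 2 * hk1 + hk2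
        have q2 : (9 * D) * v = ((k1 + 2 * k2 : ℤ) : ℚ) := by
          push_cast; linear_combination hk1 + 2 * hk2
        have q0' := congrArg (Rat.cast : ℚ → K) q0
        have q1' := congrArg (Rat.cast : ℚ → K) q1
        have q2' := congrArg (Rat.cast : ℚ → K) q2
        rw [hxr, zsmul_eq_mul]
        push_cast at q0' q1' q2' ⊢
        linear_combination q0' + α * q1' + α' * q2'
      have hMmem : ∀ i j k : ℤ, (i : K) + j * α + k * α' ∈ M := by
        intro i j k
        have : (i : K) + j * α + k * α' = i • (1 : K) + j • α + k • α' := by simp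
        rw [this]
        exact M.add_mem (M.add_mem (M.smul_mem _ m1) (M.smul_mem _ mα)) (M.smul_mem _ mα')
      have h9x : (9 * D) • x ∈ M := by rw [hDx]; exact hMmem _ _ _
      have hαA : α ∈ Algebra.adjoin ℤ {α} := Algebra.self_mem_adjoin_singleton ℤ α
      have hyA : (9 * D) • (y₁ • x) ∈ Algebra.adjoin ℤ {α} := by
        have : (9 * D) • (y₁ • x) = ((y₁ * (3 * D * k0) - 2 * D * (k1 + 2 * k2) : ℤ) : K)
            + ((y₁ * (2 * k1 + k2) - y₀ * (k1 + 2 * k2) : ℤ) : K) * α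
            + ((k1 + 2 * k2 : ℤ) : K) * α ^ 2 := by
          rw [smul_comm, hDx, zsmul_eq_mul]
          push_cast
          linear_combination (-(k1 + 2 * k2) : K) * s
        rw [this]
        exact add_mem (add_mem (intCast_mem _ _) (mul_mem (intCast_mem _ _) hαA))
          (mul_mem (intCast_mem _ _) (pow_mem hαA 2))
      have hyx : y₁ • x ∈ Algebra.adjoin ℤ {α} := by
        refine strip_aux _ (9 * D) (mul_ne_zero (by norm_num) hD) ?_ _ (hx.smul _) hyA
        intro p hp hpD
        rcases hp.dvd_or_dvd hpD with h | h
        · have h3 : p ∣ 3 := hp.dvd_of_dvd_pow (n := 2) (by norm_num; exact h)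
          obtain ⟨w, hw⟩ := (hp.associated_of_dvd Int.prime_three h3)
          intro z hz hpz
          refine hst3 z hz ?_
          rw [← hw, mul_comm, mul_smul]
          exact Subalgebra.smul_mem _ hpz _
        · refine (cubic_eis hK α p 0 (-3 * D) (-(D * (2 * y₀ - y₁))) hp (dvd_zero _)
            (h.mul_left _) ((h.mul_right _).neg_right) ?_ hc).2.2
          intro h2
          rw [dvd_neg] at h2
          have hcp : IsCoprime (p ^ 2) (2 * y₀ - y₁) :=
            ((hp.coprime_iff_not_dvd).2 (hpt p hp h)).pow_left
          have := hcp.dvd_of_dvd_mul_right h2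
          rw [pow_two] at this
          exact hp.not_isUnit (hsq p this)
      have hAM : ∀ z ∈ Algebra.adjoin ℤ {α}, z ∈ M := by
        intro z hz
        have : ∃ i j k : ℤ, z = (i : K) + j * α + k * α' := by
          induction hz using Algebra.adjoin_induction with
          | mem z hz =>
            obtain rfl : z = α := hz
            exact ⟨0, 1, 0, by simp⟩
          | algebraMap t => exact ⟨t, 0, 0, by simp⟩
          | add z w _ _ h1 h2 =>
            obtain ⟨i, j, k, rfl⟩ := h1
            obtain ⟨i', j', k', rfl⟩ := h2
            exact ⟨i + i', j + j', k + k', by push_cast; ring⟩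
          | mul z w _ _ h1 h2 =>
            obtain ⟨i, j, k, rfl⟩ := h1
            obtain ⟨i', j', k', rfl⟩ := h2
            refine ⟨i * i' + j * j' * (2 * D) + (j * k' + k * j') * (-D) + k * k' * (2 * D),
              i * j' + j * i' + j * j' * y₀ + (j * k' + k * j') * (y₁ - y₀) - k * k' * y₁,
              i * k' + k * i' + j * j' * y₁ - (j * k' + k * j') * y₀ + k * k' * (y₀ - y₁), ?_⟩
            rw [e''] at hm s'
            push_cast
            linear_combination (j * j' : K) * s + (j * k' + k * j' : K) * hm + (k * k' : K) * s'
        obtain ⟨i, j, k, rfl⟩ := this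
        exact hMmem i j k
      obtain ⟨a, b, hab⟩ := hcop
      have : x = a • ((9 * D) • x) + b • (y₁ • x) := by
        rw [smul_smul, smul_smul, ← add_smul, hab, one_smul]
      rw [this]
      exact M.add_mem (M.smul_mem _ h9x) (M.smul_mem _ (hAM _ hyx))
  · rw [eq_bot_iff]
    rintro z ⟨h1, h2⟩
    obtain ⟨k, rfl⟩ := Submodule.mem_span_singleton.1 h2
    have h0 : Algebra.trace ℚ K (k • (1 : K)) = 0 := by
      have : Submodule.span ℤ {α, α', α''} ≤
          (LinearMap.ker (Algebra.trace ℚ K)).restrictScalars ℤ := by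
        refine Submodule.span_le.2 ?_
        rintro z (rfl | rfl | rfl)
        exacts [ht, ht', ht'']
      exact this h1
    have e : k • (1 : K) = algebraMap ℚ K k := by simp
    rw [e, Algebra.trace_algebraMap, hK] at h0
    have : k = 0 := by simpa using h0
    simp [this]

theorem finrank_aux {K : Type*} [Field K] [NumberField K] (n : ℤ) (ρ : K)
    (hρ : ρ ^ 3 - (n : K) * ρ ^ 2 - ((n : K) + 3) * ρ - 1 = 0)
    (hgen : Algebra.adjoin ℚ {ρ} = ⊤) : Module.finrank ℚ K = 3 := by
  have hdeg : (X ^ 3 + C (-n) * X ^ 2 + C (-(n + 3)) * X + C (-1) : ℤ[X]).natDegree = 3 := by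
    compute_degree!
  have hmon : (X ^ 3 + C (-n) * X ^ 2 + C (-(n + 3)) * X + C (-1) : ℤ[X]).Monic := by monicity!
  have hirr : Irreducible (X ^ 3 + C (-n) * X ^ 2 + C (-(n + 3)) * X + C (-1) : ℤ[X]) := by
    rw [hmon.irreducible_iff_roots_eq_zero_of_degree_le_three (by omega) (by omega),
      Multiset.eq_zero_iff_forall_notMem]
    intro r hr
    have hr := (mem_roots'.1 hr).2
    simp only [IsRoot.def, eval_add, eval_mul, eval_pow, eval_X, eval_C] at hr
    have h1 : r * (r ^ 2 - n * r - (n + 3)) = 1 := by linear_combination hr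
    rcases Int.isUnit_iff.1 (IsUnit.of_mul_eq_one _ h1) with rfl | rfl
    · omega
    · omega
  have hae : aeval ρ (X ^ 3 + C (-n) * X ^ 2 + C (-(n + 3)) * X + C (-1) : ℤ[X]) = 0 := by
    rw [aeval_def]
    simp only [eval₂_add, eval₂_mul, eval₂_pow, eval₂_X, eval₂_C]
    simp only [eq_intCast]
    push_cast
    linear_combination hρ
  have hm := (minpoly_aux ρ _ hmon hirr hae).2
  have hint : IsIntegral ℚ ρ := IsIntegral.tower_top (R := ℤ) ⟨_, hmon, hae⟩
  let B := PowerBasis.ofAdjoinEqTop hint hgen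
  have hB : B.gen = ρ := PowerBasis.ofAdjoinEqTop_gen hint hgen
  rw [B.finrank, ← B.natDegree_minpoly, hB, hm,
    natDegree_map_eq_of_injective (algebraMap ℤ ℚ).injective_int, hdeg]

theorem ring_of_integers_decomposition_case06
    (n : ℤ) (hn : n % 9 = 0 ∨ n % 9 = 6)
    {K : Type*} [Field K] [NumberField K]
    (ρ ρ' ρ'' : K)
    (hρ : ρ ^ 3 - (n : K) * ρ ^ 2 - ((n : K) + 3) * ρ - 1 = 0)
    (h1 : 1 + ρ ≠ 0) (hρ' : ρ' = -1 / (1 + ρ))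
    (h1' : 1 + ρ' ≠ 0) (hρ'' : ρ'' = -1 / (1 + ρ'))
    (hgen : Algebra.adjoin ℚ {ρ} = ⊤)
    (d e c : ℤ) (hd : 0 < d) (he : 0 < e) (hc : 0 < c)
    (hsqd : Squarefree d) (hsqe : Squarefree e) (hde : IsCoprime d e)
    (hΔ : n ^ 2 + 3 * n + 9 = d * e ^ 2 * c ^ 3)
    (a₀ a₁ : ℤ) (hec : e * c = 3 * (a₀ ^ 2 - a₀ * a₁ + a₁ ^ 2))
    (hdvd : ((a₀ : AdjoinRoot (X ^ 2 + X + 1 : ℤ[X])) +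
        (a₁ : AdjoinRoot (X ^ 2 + X + 1 : ℤ[X])) * AdjoinRoot.root _) ∣
        ((n : AdjoinRoot (X ^ 2 + X + 1 : ℤ[X])) + 3 + 3 * AdjoinRoot.root _))
    (α α' α'' : K)
    (hα : α = (3 * a₀ * ρ + 3 * a₁ * ρ' - n * (a₀ + a₁)) / (e * c ^ 2))
    (hα' : α' = (3 * a₀ * ρ' + 3 * a₁ * ρ'' - n * (a₀ + a₁)) / (e * c ^ 2))
    (hα'' : α'' = (3 * a₀ * ρ'' + 3 * a₁ * ρ - n * (a₀ + a₁)) / (e * c ^ 2)) :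
    IsIntegral ℤ α ∧
    Submodule.span ℤ {α, α', α''} ⊔ Submodule.span ℤ {(1 : K)} =
      Subalgebra.toSubmodule (integralClosure ℤ K) ∧
    Submodule.span ℤ {α, α', α''} ⊓ Submodule.span ℤ {(1 : K)} = ⊥ := by
  obtain ⟨b₀, b₁, hb₀, hb₁⟩ := dvd_aux n a₀ a₁ hdvd
  have hK : Module.finrank ℚ K = 3 := finrank_aux n ρ hρ hgen
  obtain ⟨m, E, y₀, y₁, rfl, rfl, hE, hN, hB, hu, hv, hNy, hcop, hsq, h3, hpt, h9⟩ :=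
    arith_aux n d e c a₀ a₁ b₀ b₁ hn hd he hc hsqd hsqe hde hΔ hec hb₀ hb₁
  have hρ0 : ρ ≠ 0 := by
    rintro rfl
    simp at hρ
  have r1 : ρ' * (1 + ρ) = -1 := by rw [hρ']; field_simp
  have r2 : ρ'' * (1 + ρ') = -1 := by rw [hρ'']; field_simp
  have r3 : ρ * (1 + ρ'') = -1 := by
    apply mul_left_cancel₀ (mul_ne_zero h1 h1')
    linear_combination ρ * (1 + ρ) * r2 + (1 + ρ) * r1
  have rs : ρ + ρ' + ρ'' = 3 * m := by
    apply mul_left_cancel₀ (mul_ne_zero h1 hρ0)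
    push_cast at hρ
    linear_combination hρ + ρ * r1 + (1 + ρ) * r3
  have hw : (E * c ^ 2 : K) ≠ 0 := by
    have : (E * c ^ 2 : ℤ) ≠ 0 := by positivity
    exact_mod_cast this
  have form : ∀ t t' x : K, x = (3 * a₀ * t + 3 * a₁ * t' - (3 * m : ℤ) * (a₀ + a₁))
        / ((3 * E : ℤ) * c ^ 2) →
      (E * c ^ 2) * x = a₀ * t + a₁ * t' - m * (a₀ + a₁) := by
    intro t t' x hx
    rw [hx]
    have hE0 : (E : K) ≠ 0 := left_ne_zero_of_mul hw
    have hc0 : (c : K) ≠ 0 := by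
      have := right_ne_zero_of_mul hw
      exact fun h => this (by rw [h]; ring)
    push_cast
    field_simp
  have f := form _ _ _ hα
  have f' := form _ _ _ hα'
  have f'' := form _ _ _ hα''
  have huK := congrArg (Int.cast : ℤ → K) hu
  have hvK := congrArg (Int.cast : ℤ → K) hv
  have hBK := congrArg (Int.cast : ℤ → K) hB
  have hNK := congrArg (Int.cast : ℤ → K) hN
  push_cast at huK hvK hBK hNK
  have sq : ∀ t t' t'' x x' : K, t' * (1 + t) = -1 → t'' * (1 + t') = -1 → t * (1 + t'') = -1 →
      t + t' + t'' = 3 * m → (E * c ^ 2) * x = a₀ * t + a₁ * t' - m * (a₀ + a₁) →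
      (E * c ^ 2) * x' = a₀ * t' + a₁ * t'' - m * (a₀ + a₁) →
      x ^ 2 = 2 * (d * E : ℤ) + y₀ * x + y₁ * x' := by
    intro t t' t'' x x' h1 h2 h3 h4 hx hx'
    obtain rfl : t'' = 3 * m - t - t' := by linear_combination h4
    apply mul_left_cancel₀ (pow_ne_zero 2 hw)
    have l1 : ((E * c ^ 2) * x) ^ 2 = (a₀ * t + a₁ * t' - m * (a₀ + a₁)) ^ 2 := by rw [hx]
    have q1 : t ^ 2 = (3 * m + 1) * t + t' + 2 := by linear_combination -h3 - h1
    have q2 : t' ^ 2 = (3 * m + 1) * t' + (3 * m - t - t') + 2 := by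
      linear_combination -h2 - h1
    have q3 : t * t' = - 1 - t' := by linear_combination h1
    have l2 : (E * c ^ 2 : K) ^ 2 * (d * E) = (a₀ ^ 2 - a₀ * a₁ + a₁ ^ 2) * (m ^ 2 + m + 1) := by
      rw [hNK, ← hBK]; ring
    push_cast
    linear_combination l1 + a₀ ^ 2 * q1 + a₁ ^ 2 * q2 + 2 * a₀ * a₁ * q3 - 2 * l2
      - (E * c ^ 2) * y₀ * hx - (E * c ^ 2) * y₁ * hx' - (t - m) * huK - (t' - m) * hvK
  have hsum : α + α' + α'' = 0 := by
    apply mul_left_cancel₀ hw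
    linear_combination f + f' + f'' + (a₀ + a₁) * rs
  exact core_aux hK α α' α'' (d * E) y₀ y₁ (by positivity) hsum
    (sq ρ ρ' ρ'' α α' r1 r2 r3 rs f f')
    (sq ρ' ρ'' ρ α' α'' r2 r3 r1 (by linear_combination rs) f' f'')
    (sq ρ'' ρ ρ' α'' α r3 r1 r2 (by linear_combination rs) f'' f)
    hNy hcop hsq h3 hpt h9
end
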